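/- arXiv:2304.05878 — 3 statements merged into one kernel-verified Lean document; each statement's English description precedes it below -/
import Mathlib

section
/- Let P be an irreducible reversible transition matrix on finite V with stationary distribution π, B a nonempty proper subset of V, and β(B) the largest eigenvalue of P_B with quasi-stationary distribution α^B. Then ℙ_{π_B}[T_{B^c} > m] can be written as Σ_{i=1}^{|B|} c_i² γ_i^m, where γ_1 ≥ ... ≥ γ_{|B|} are the eigenvalues of P_B (viewed as a self-adjoint operator with respect to the inner product weighted by π_B) and the coefficients satisfy Σ c_i² = 1; in particular, (λ(B) ‖α^B/π_B‖²_{2,π_B})^{-1} ≤ E_{π_B}[T_{B^c}] ≤ 1/λ(B), where λ(B) := 1 - β(B). -/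
open Finset Matrix

section Defs
variable {V : Type*} [Fintype V] [DecidableEq V]

/-- `P` is a stochastic matrix: nonneg entries, rows sum to 1. -/
def IsStochastic (P : Matrix V V ℝ) : Prop :=
  (∀ x y, 0 ≤ P x y) ∧ ∀ x, ∑ y, P x y = 1

/-- `P` is irreducible. -/
def IsIrreducibleMat (P : Matrix V V ℝ) : Prop :=
  ∀ x y, ∃ n : ℕ, 0 < (P ^ n) x y

/-- `P` is reversible w.r.t. `π`. -/
def IsReversible (P : Matrix V V ℝ) (π : V → ℝ) : Prop :=
  ∀ x y, π x * P x y = π y * P y x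

/-- Restriction `P_B` of `P` to the set `B` (kept as a `V × V` matrix). -/
def res (P : Matrix V V ℝ) (B : Finset V) : Matrix V V ℝ :=
  fun x y => if x ∈ B ∧ y ∈ B then P x y else 0

/-- `ℙ_μ[T_{Bᶜ} > m]`: the chain started from `μ` stays in `B` for steps `0,…,m`. -/
def survGT (P : Matrix V V ℝ) (μ : V → ℝ) (B : Finset V) (m : ℕ) : ℝ :=
  ∑ x, ∑ y, μ x * (res P B ^ m) x y

/-- `E_μ[T_{Bᶜ}]`, the expected exit time from `B` started from `μ`. -/
noncomputable def expExit (P : Matrix V V ℝ) (μ : V → ℝ) (B : Finset V) : ℝ :=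
  ∑' m : ℕ, survGT P μ B m

/-- `π` conditioned on `B`. -/
noncomputable def condOn (π : V → ℝ) (B : Finset V) : V → ℝ :=
  fun x => if x ∈ B then π x / (∑ b ∈ B, π b) else 0

/-- The largest (real) eigenvalue of a matrix. -/
noncomputable def topEigM (M : Matrix V V ℝ) : ℝ :=
  sSup {β : ℝ | ∃ f : V → ℝ, f ≠ 0 ∧ M *ᵥ f = β • f}

/-- `β(B)`: the largest eigenvalue of the restriction `P_B`. -/
noncomputable def topEig (P : Matrix V V ℝ) (B : Finset V) : ℝ :=
  topEigM (res P B)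

/-- The second largest eigenvalue of `P`. -/
noncomputable def secondEig (P : Matrix V V ℝ) : ℝ :=
  sSup {β : ℝ | β ≠ 1 ∧ ∃ f : V → ℝ, f ≠ 0 ∧ P *ᵥ f = β • f}

end Defs


theorem aux_spec {n : Type*} [Fintype n] [DecidableEq n] (A : Matrix n n ℝ) (hA : A.IsSymm) :
    ∃ (u : n → n → ℝ) (γ : n → ℝ), (∀ i, ∑ x, u i x * u i x = 1) ∧
      (∀ g : n → ℝ, ∀ x, g x = ∑ i, (∑ y, u i y * g y) * u i x) ∧
      (∀ i, A *ᵥ u i = γ i • u i) := by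
  have hH : A.IsHermitian := by
    ext i j
    simpa using hA.apply i j
  refine ⟨fun i => hH.eigenvectorBasis i, hH.eigenvalues, ?_, ?_, ?_⟩
  · intro i
    have h := hH.eigenvectorBasis.orthonormal.1 i
    have h2 : inner ℝ (hH.eigenvectorBasis i) (hH.eigenvectorBasis i) = (1 : ℝ) := by
      rw [real_inner_self_eq_norm_sq, h]; norm_num
    rw [PiLp.inner_apply] at h2
    simpa [sq] using h2
  · intro g x
    have h := hH.eigenvectorBasis.sum_repr' (WithLp.toLp 2 g)
    have h2 := congrArg (fun z : EuclideanSpace ℝ n => z x) h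
    simp only [PiLp.inner_apply] at h2
    simp only [WithLp.ofLp_sum, WithLp.ofLp_smul, Finset.sum_apply, Pi.smul_apply,
      smul_eq_mul] at h2
    rw [← h2]
    refine Finset.sum_congr rfl fun i _ => ?_
    congr 1
    refine Finset.sum_congr rfl fun y _ => ?_
    simp [mul_comm]
  · intro i
    exact hH.mulVec_eigenvectorBasis i

theorem aux_closed {V : Type*} [Fintype V] [DecidableEq V]
    (P : Matrix V V ℝ) (hP : IsStochastic P) (hirr : IsIrreducibleMat P)
    (S : V → Prop) (hS : ∀ x y, S x → P x y ≠ 0 → S y) (x : V) (hx : S x) (y : V) : S y := by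
  have key : ∀ n : ℕ, ∀ y, (P ^ n) x y ≠ 0 → S y := by
    intro n
    induction n with
    | zero =>
      intro y hy
      by_cases h : x = y
      · exact h ▸ hx
      · simp [Matrix.one_apply, h] at hy
    | succ k ih =>
      intro y hy
      rw [pow_succ, Matrix.mul_apply] at hy
      obtain ⟨z, -, hz⟩ := Finset.exists_ne_zero_of_sum_ne_zero hy
      exact hS z y (ih z (left_ne_zero_of_mul hz)) (right_ne_zero_of_mul hz)
  obtain ⟨n, hn⟩ := hirr x y
  exact key n y hn.ne'

theorem aux_eig_lt {V : Type*} [Fintype V] [DecidableEq V]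
    (P : Matrix V V ℝ) (hP : IsStochastic P) (hirr : IsIrreducibleMat P)
    (B : Finset V) (hBproper : B ≠ Finset.univ) (γ : ℝ) (f : V → ℝ) (hf : f ≠ 0)
    (h : res P B *ᵥ f = γ • f) : |γ| < 1 := by
  by_contra! hγ
  obtain ⟨x0, hx0⟩ : ∃ x, f x ≠ 0 := by
    by_contra! h0
    exact hf (funext h0)
  obtain ⟨z, hz⟩ : ∃ z, z ∉ B := by
    by_contra! h0
    exact hBproper (Finset.eq_univ_of_forall h0)
  obtain ⟨x, -, hx⟩ := Finset.exists_max_image Finset.univ (fun x => |f x|) ⟨x0, Finset.mem_univ _⟩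
  have hx' : ∀ y, |f y| ≤ |f x| := fun y => hx y (Finset.mem_univ _)
  have hpos : 0 < |f x| := lt_of_lt_of_le (abs_pos.2 hx0) (hx' x0)
  have hfz : f z = 0 := by
    have h1 := congrFun h z
    simp [Matrix.mulVec, dotProduct, res, hz] at h1
    rcases h1 with h1 | h1
    · rw [h1] at hγ; norm_num at hγ
    · exact h1
  have hc := aux_closed P hP hirr (fun y => |f y| = |f x|) (by
    intro a b ha hab
    by_contra hb
    have hb' : |f b| < |f x| := lt_of_le_of_ne (hx' b) hb
    have h1 := congrFun h a
    have h2 : |γ| * |f a| ≤ ∑ y, P a y * |f y| := by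
      have : γ * f a = ∑ y, res P B a y * f y := by
        simpa [Matrix.mulVec, dotProduct] using h1.symm
      rw [← abs_mul, this]
      refine (Finset.abs_sum_le_sum_abs _ _).trans (Finset.sum_le_sum fun y _ => ?_)
      rw [abs_mul]
      refine mul_le_mul_of_nonneg_right ?_ (abs_nonneg _)
      unfold res
      split_ifs
      · rw [abs_of_nonneg (hP.1 a y)]
      · simpa using hP.1 a y
    have h3 : ∑ y, P a y * |f y| < ∑ y, P a y * |f x| := by
      refine Finset.sum_lt_sum (fun y _ => mul_le_mul_of_nonneg_left (hx' y) (hP.1 a y))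
        ⟨b, Finset.mem_univ _, ?_⟩
      exact mul_lt_mul_of_pos_left hb' (lt_of_le_of_ne (hP.1 a b) (Ne.symm hab))
    rw [← Finset.sum_mul, hP.2 a, one_mul] at h3
    rw [ha] at h2
    nlinarith) x rfl z
  simp only [hfz, abs_zero] at hc
  linarith

theorem aux_surv {V : Type*} [Fintype V] [DecidableEq V]
    (P : Matrix V V ℝ) (B : Finset V) (μ : V → ℝ) (hμ : ∀ x ∉ B, μ x = 0) (m : ℕ) :
    survGT P μ B m = ∑ x, μ x * ((res P B ^ m) *ᵥ (fun y => if y ∈ B then 1 else 0)) x := by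
  unfold survGT
  refine Finset.sum_congr rfl fun x _ => ?_
  by_cases hx : x ∈ B
  · rw [← Finset.mul_sum]
    congr 1
    simp only [Matrix.mulVec, dotProduct]
    refine Finset.sum_congr rfl fun y _ => ?_
    by_cases hy : y ∈ B
    · simp [hy]
    · simp only [hy, if_false, mul_zero]
      cases m with
      | zero =>
        have : x ≠ y := fun h => hy (h ▸ hx)
        simp [Matrix.one_apply, this]
      | succ k =>
        rw [pow_succ, Matrix.mul_apply]
        exact Finset.sum_eq_zero fun z _ => by simp [res, hy]
  · simp [hμ x hx]

theorem aux_pow {V : Type*} [Fintype V] [DecidableEq V] (M : Matrix V V ℝ) (γ : ℝ) (f : V → ℝ)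
    (h : M *ᵥ f = γ • f) (m : ℕ) : (M ^ m) *ᵥ f = γ ^ m • f := by
  induction m with
  | zero => simp
  | succ k ih =>
    rw [pow_succ, ← Matrix.mulVec_mulVec, h, Matrix.mulVec_smul, ih, smul_smul, pow_succ, mul_comm]

theorem aux_sort {n : Type*} [Fintype n] (N : ℕ) (hN : Fintype.card n = N) (γ : n → ℝ) :
    ∃ e : Fin N ≃ n, Antitone (γ ∘ e) := by
  let e0 : Fin N ≃ n := (Fintype.equivFinOfCardEq hN).symm
  let g : Fin N → ℝ := fun i => - γ (e0 i)
  refine ⟨(Tuple.sort g).trans e0, ?_⟩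
  intro i j hij
  have := Tuple.monotone_sort g hij
  simp only [g, Function.comp] at this
  simp only [Function.comp, Equiv.trans_apply]
  linarith

/-- The main spectral data on `B`. -/
theorem aux_main {V : Type*} [Fintype V] [DecidableEq V]
    (P : Matrix V V ℝ) (B : Finset V) (μ : V → ℝ) (hμ0 : ∀ x ∉ B, μ x = 0)
    (hμpos : ∀ x ∈ B, 0 < μ x) (hμsum : ∑ x, μ x = 1)
    (hrev : ∀ x ∈ B, ∀ y ∈ B, μ x * P x y = μ y * P y x)
    (α : V → ℝ) (hαsupp : ∀ x ∉ B, α x = 0) (hαsum : ∑ x, α x = 1) (β : ℝ)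
    (hqs : α ᵥ* res P B = β • α) :
    ∃ (c d γ : B → ℝ),
      (∀ i, ∃ f : V → ℝ, f ≠ 0 ∧ (∀ x ∉ B, f x = 0) ∧ res P B *ᵥ f = γ i • f) ∧
      (∀ m : ℕ, survGT P μ B m = ∑ i, c i ^ 2 * γ i ^ m) ∧
      (∑ i, c i ^ 2 = 1) ∧
      (∑ i, c i * d i = 1) ∧ (∑ i, d i ^ 2 = ∑ b ∈ B, α b ^ 2 / μ b) ∧
      (∀ i, γ i * d i = β * d i) := by
  have hsum : ∀ F : V → ℝ, (∀ x ∉ B, F x = 0) → ∑ x, F x = ∑ x : B, F x := by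
    intro F hF
    rw [Finset.sum_coe_sort B F]
    exact (Finset.sum_subset (Finset.subset_univ B) fun x _ hx => hF x hx).symm
  have hs : ∀ x : B, 0 < √(μ x) := fun x => Real.sqrt_pos.2 (hμpos x x.2)
  have hs2 : ∀ x : B, √(μ x) * √(μ x) = μ x := fun x => Real.mul_self_sqrt (hμpos x x.2).le
  let A : Matrix B B ℝ := fun x y => √(μ x) * P x y / √(μ y)
  have hA : A.IsSymm := by
    ext x y
    change √(μ y) * P y x / √(μ x) = √(μ x) * P x y / √(μ y)
    rw [div_eq_div_iff (hs x).ne' (hs y).ne']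
    have := hrev x x.2 y y.2
    rw [← hs2 x, ← hs2 y] at this
    linarith
  obtain ⟨u, γ, hu1, hexp, hγ⟩ := aux_spec A hA
  have parseval : ∀ g k : B → ℝ, ∑ i, (∑ y, u i y * g y) * (∑ y, u i y * k y) = ∑ x, g x * k x := by
    intro g k
    calc _ = ∑ i, ∑ y, ((∑ y, u i y * g y) * u i y) * k y := by
          refine Finset.sum_congr rfl fun i _ => ?_
          rw [Finset.mul_sum]
          exact Finset.sum_congr rfl fun y _ => by ring
      _ = ∑ y, (∑ i, (∑ y, u i y * g y) * u i y) * k y := by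
          rw [Finset.sum_comm]
          exact Finset.sum_congr rfl fun y _ => by rw [Finset.sum_mul]
      _ = _ := Finset.sum_congr rfl fun y _ => by rw [← hexp g y]
  let v : B → ℝ := fun x => √(μ x)
  let g : B → ℝ := fun x => α x / √(μ x)
  let c : B → ℝ := fun i => ∑ y, u i y * v y
  let d : B → ℝ := fun i => ∑ y, u i y * g y
  let f : B → V → ℝ := fun i x => if h : x ∈ B then u i ⟨x, h⟩ / √(μ x) else 0
  have hfB : ∀ i (x : B), f i x = u i x / √(μ x) := fun i x => by simp [f]
  have hf0 : ∀ i, ∀ x ∉ B, f i x = 0 := fun i x hx => by simp [f, hx]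
  have hresB : ∀ x y : B, res P B x y = P x y := fun x y => by simp [res]
  have hres0 : ∀ x, ∀ y ∉ B, res P B x y = 0 := fun x y hy => by simp [res, hy]
  have hres0' : ∀ x ∉ B, ∀ y, res P B x y = 0 := fun x hx y => by simp [res, hx]
  have hfe : ∀ i, res P B *ᵥ f i = γ i • f i := by
    intro i
    ext x
    simp only [Matrix.mulVec, dotProduct, Pi.smul_apply, smul_eq_mul]
    by_cases hx : x ∈ B
    · rw [hsum _ (fun y hy => by simp [hf0 i y hy])]
      have h1 := congrFun (hγ i) ⟨x, hx⟩
      simp only [Matrix.mulVec, dotProduct, Pi.smul_apply, smul_eq_mul, A] at h1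
      have h2 := hfB i ⟨x, hx⟩
      simp only at h2
      have h3 := hs ⟨x, hx⟩
      simp only at h3
      rw [h2, ← mul_div_assoc, ← h1, Finset.sum_div]
      refine Finset.sum_congr rfl fun y _ => ?_
      have h4 := hresB ⟨x, hx⟩ y
      simp only at h4
      have h5 := hs y
      rw [hfB, h4]
      field_simp
    · rw [hf0 i x hx, mul_zero]
      exact Finset.sum_eq_zero fun y _ => by rw [hres0' x hx, zero_mul]
  have hμf : ∀ i, ∑ x, μ x * f i x = c i := by
    intro i
    rw [hsum _ (fun y hy => by simp [hf0 i y hy])]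
    refine Finset.sum_congr rfl fun y _ => ?_
    have h5 := hs y
    have h6 : μ y * (u i y / √(μ y)) = √(μ y) * √(μ y) * (u i y / √(μ y)) := by rw [hs2 y]
    rw [hfB, h6]
    simp only [v]
    field_simp
  have h1B : (fun y => if y ∈ B then (1:ℝ) else 0) = ∑ i, c i • f i := by
    ext x
    simp only [Finset.sum_apply, Pi.smul_apply, smul_eq_mul]
    by_cases hx : x ∈ B
    · have h1 := hexp v ⟨x, hx⟩
      have h3 := hs ⟨x, hx⟩
      simp only [hx, if_true]
      simp only at h3
      have : ∑ i, c i * f i x = (∑ i, c i * u i ⟨x, hx⟩) / √(μ x) := by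
        rw [Finset.sum_div]
        refine Finset.sum_congr rfl fun i _ => ?_
        rw [hfB i ⟨x, hx⟩, mul_div_assoc]
      rw [this, ← h1]
      exact (div_self h3.ne').symm
    · simp [hx, hf0]
  have hsurv : ∀ m : ℕ, survGT P μ B m = ∑ i, c i ^ 2 * γ i ^ m := by
    intro m
    rw [aux_surv P B μ hμ0 m, h1B, Matrix.mulVec_sum]
    simp only [Matrix.mulVec_smul, aux_pow _ _ _ (hfe _) m, Finset.sum_apply, Pi.smul_apply,
      smul_eq_mul, Finset.mul_sum]
    rw [Finset.sum_comm]
    refine Finset.sum_congr rfl fun i _ => ?_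
    calc _ = c i * γ i ^ m * ∑ x, μ x * f i x := by
          rw [Finset.mul_sum]
          exact Finset.sum_congr rfl fun y _ => by ring
      _ = _ := by rw [hμf]; ring
  refine ⟨c, d, γ, ?_, hsurv, ?_, ?_, ?_, ?_⟩
  · intro i
    refine ⟨f i, ?_, hf0 i, hfe i⟩
    intro h0
    have : ∀ x, u i x = 0 := by
      intro x
      have h1 := hfB i x
      rw [h0] at h1
      have := (div_eq_zero_iff.1 h1.symm).resolve_right (hs x).ne'
      exact this
    have h1 := hu1 i
    simp [this] at h1
  · have := parseval v v
    calc _ = ∑ i, c i * c i := Finset.sum_congr rfl fun i _ => by ring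
      _ = ∑ x, v x * v x := this
      _ = ∑ x : B, μ x := Finset.sum_congr rfl fun i _ => hs2 i
      _ = 1 := by rw [← hsum μ hμ0, hμsum]
  · calc _ = ∑ x, v x * g x := parseval v g
      _ = ∑ x : B, α x := Finset.sum_congr rfl fun i _ => mul_div_cancel₀ _ (hs i).ne'
      _ = 1 := by rw [← hsum α hαsupp, hαsum]
  · calc _ = ∑ i, d i * d i := Finset.sum_congr rfl fun i _ => by ring
      _ = ∑ x, g x * g x := parseval g g
      _ = ∑ x : B, α x ^ 2 / μ x := Finset.sum_congr rfl fun i _ => by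
          simp only [g]
          rw [div_mul_div_comm, hs2 i, sq]
      _ = _ := Finset.sum_coe_sort B fun x => α x ^ 2 / μ x
  · intro i
    have hAg : ∀ y, ∑ x, A y x * g x = β * g y := by
      intro y
      have h1 := congrFun hqs y
      simp only [Matrix.vecMul, dotProduct, Pi.smul_apply, smul_eq_mul] at h1
      rw [hsum _ (fun y hy => by simp [hαsupp y hy])] at h1
      simp only [g]
      rw [← mul_div_assoc, ← h1, Finset.sum_div]
      refine Finset.sum_congr rfl fun x _ => ?_
      rw [hresB, ← hA.apply]
      simp only [A]
      have := hs x
      have := hs y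
      field_simp
    have hAu : ∀ x, ∑ y, A x y * u i y = γ i * u i x := fun x => congrFun (hγ i) x
    calc γ i * d i = ∑ x, (γ i * u i x) * g x := by
          simp only [d, Finset.mul_sum]
          exact Finset.sum_congr rfl fun y _ => by ring
      _ = ∑ x, ∑ y, A x y * u i y * g x := by
          refine Finset.sum_congr rfl fun y _ => ?_
          rw [← hAu, Finset.sum_mul]
      _ = ∑ y, u i y * (β * g y) := by
          rw [Finset.sum_comm]
          refine Finset.sum_congr rfl fun y _ => ?_
          rw [← hAg, Finset.mul_sum]
          refine Finset.sum_congr rfl fun x _ => ?_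
          rw [hA.apply]; ring
      _ = β * d i := by
          simp only [d, Finset.mul_sum]
          exact Finset.sum_congr rfl fun y _ => by ring

/-- spectral decomposition of the exit-time tail from `π_B`, and the
two-sided bound `(λ(B)·‖α^B/π_B‖²)⁻¹ ≤ E_{π_B}[T_{Bᶜ}] ≤ 1/λ(B)`. -/
theorem stmt_1 {V : Type*} [Fintype V] [DecidableEq V]
    (P : Matrix V V ℝ) (π : V → ℝ)
    (hP : IsStochastic P) (hirr : IsIrreducibleMat P)
    (hπpos : ∀ x, 0 < π x) (hπsum : ∑ x, π x = 1)
    (hrev : IsReversible P π)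
    (B : Finset V) (hBne : B.Nonempty) (hBproper : B ≠ Finset.univ)
    (α : V → ℝ) (hα0 : ∀ x, 0 ≤ α x) (hαsupp : ∀ x ∉ B, α x = 0)
    (hαsum : ∑ x, α x = 1)
    (hqs : α ᵥ* res P B = topEig P B • α) :
    (∃ (c γ : Fin B.card → ℝ),
        Antitone γ ∧
        (∀ i, γ i = topEig P B ∨ γ i < topEig P B) ∧
        (∀ i, ∃ f : V → ℝ, f ≠ 0 ∧ (∀ x ∉ B, f x = 0) ∧ res P B *ᵥ f = γ i • f) ∧
        (∑ i, c i ^ 2 = 1) ∧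
        (∀ m : ℕ, survGT P (condOn π B) B m = ∑ i, c i ^ 2 * γ i ^ m)) ∧
      ((1 - topEig P B) * ∑ b ∈ B, (α b) ^ 2 / condOn π B b)⁻¹
          ≤ expExit P (condOn π B) B ∧
      expExit P (condOn π B) B ≤ (1 - topEig P B)⁻¹ := by
  have hZ : 0 < ∑ b ∈ B, π b := Finset.sum_pos (fun b _ => hπpos b) hBne
  have hμ0 : ∀ x ∉ B, condOn π B x = 0 := fun x hx => by simp [condOn, hx]
  have hμB : ∀ x ∈ B, condOn π B x = π x / ∑ b ∈ B, π b := fun x hx => by simp [condOn, hx]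
  have hμpos : ∀ x ∈ B, 0 < condOn π B x := fun x hx => by
    rw [hμB x hx]; exact div_pos (hπpos x) hZ
  have hμsum : ∑ x, condOn π B x = 1 := by
    rw [← Finset.sum_subset (Finset.subset_univ B) fun x _ hx => hμ0 x hx,
      Finset.sum_congr rfl hμB, ← Finset.sum_div, div_self hZ.ne']
  have hrev' : ∀ x ∈ B, ∀ y ∈ B, condOn π B x * P x y = condOn π B y * P y x := by
    intro x hx y hy
    rw [hμB x hx, hμB y hy, div_mul_eq_mul_div, div_mul_eq_mul_div, hrev x y]
  obtain ⟨c, d, γ, hf, hsurv, hc1, hcd, hd, hγd⟩ := aux_main P B (condOn π B) hμ0 hμpos hμsum hrev'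
    α hαsupp hαsum (topEig P B) hqs
  have hlt : ∀ i, |γ i| < 1 := by
    intro i
    obtain ⟨f, hf1, -, hf2⟩ := hf i
    exact aux_eig_lt P hP hirr B hBproper _ f hf1 hf2
  have hle : ∀ i, γ i ≤ topEig P B := by
    intro i
    obtain ⟨f, hf1, -, hf2⟩ := hf i
    refine le_csSup ⟨1, ?_⟩ ⟨f, hf1, hf2⟩
    rintro b ⟨k, hk1, hk2⟩
    exact (le_abs_self b).trans (aux_eig_lt P hP hirr B hBproper _ k hk1 hk2).le
  have hβ : topEig P B < 1 := by
    obtain ⟨i, -, hi⟩ := Finset.exists_ne_zero_of_sum_ne_zero (hcd.trans_ne one_ne_zero)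
    have := mul_right_cancel₀ (right_ne_zero_of_mul hi) (hγd i)
    rw [← this]
    exact (le_abs_self _).trans_lt (hlt i)
  have hγ1 : ∀ i, 0 < 1 - γ i := fun i => by linarith [(le_abs_self _).trans_lt (hlt i)]
  have hE : expExit P (condOn π B) B = ∑ i, c i ^ 2 * (1 - γ i)⁻¹ := by
    unfold expExit
    simp only [hsurv]
    refine HasSum.tsum_eq (hasSum_sum fun i _ => ?_)
    exact (hasSum_geometric_of_abs_lt_one (hlt i)).mul_left _
  refine ⟨?_, ?_, ?_⟩
  · obtain ⟨e, he⟩ := aux_sort B.card (Fintype.card_coe B) γ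
    refine ⟨c ∘ e, γ ∘ e, he, fun i => (hle (e i)).eq_or_lt, fun i => hf (e i), ?_, fun m => ?_⟩
    · rw [← hc1]
      exact e.sum_comp fun i => c i ^ 2
    · rw [hsurv]
      exact (e.sum_comp fun i => c i ^ 2 * γ i ^ m).symm
  · rw [hE, ← hd]
    have h1 : (∑ i, c i * d i) ^ 2 ≤
        (∑ i, c i ^ 2 * (1 - γ i)⁻¹) * ∑ i, d i ^ 2 * (1 - γ i) := by
      refine Finset.sum_sq_le_sum_mul_sum_of_sq_eq_mul _ (fun i _ => ?_) (fun i _ => ?_)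
        (fun i _ => ?_)
      · have := hγ1 i
        positivity
      · have := hγ1 i
        positivity
      · have := (hγ1 i).ne'
        field_simp
    have h2 : ∑ i, d i ^ 2 * (1 - γ i) = (1 - topEig P B) * ∑ i, d i ^ 2 := by
      rw [Finset.mul_sum]
      refine Finset.sum_congr rfl fun i _ => ?_
      linear_combination (-d i) * hγd i
    rw [hcd, h2, one_pow] at h1
    have h3 : 0 ≤ (1 - topEig P B) * ∑ i, d i ^ 2 :=
      mul_nonneg (by linarith) (Finset.sum_nonneg fun i _ => sq_nonneg _)
    have h4 : 0 < (1 - topEig P B) * ∑ i, d i ^ 2 := by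
      refine lt_of_le_of_ne h3 fun h => ?_
      rw [← h] at h1
      norm_num at h1
    rw [inv_eq_one_div, div_le_iff₀ h4]
    exact h1
  · rw [hE]
    calc _ ≤ ∑ i, c i ^ 2 * (1 - topEig P B)⁻¹ := by
          refine Finset.sum_le_sum fun i _ => mul_le_mul_of_nonneg_left ?_ (sq_nonneg _)
          exact inv_anti₀ (by linarith) (by linarith [hle i])
      _ = _ := by rw [← Finset.sum_mul, hc1, one_mul]
end

section
/- There exists an absolute constant c₂ > 0 such that for every irreducible reversible Markov chain on a finite state space V and every nonempty B ⊊ V: c₂/λ(B) ≤ max_{D ⊆ B} E_{π_D}[T_{D^c}] ≤ 1/λ(B), where λ(B) = 1 - β(B) and β(B) is the largest eigenvalue of the restriction of P to B. (One may take c₂ = (1 - √(15/17))²/(4e^{?})-type constant arising from the martingale argument; any fixed explicit constant derived in the proof suffices.) -/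
open Finset Matrix

set_option linter.unusedSectionVars false
section Aux
variable {V : Type} [Fintype V] [DecidableEq V]

/-- Weighted inner product. -/
def ipw (π g h : V → ℝ) : ℝ := ∑ x, π x * (g x * h x)

/-- Dirichlet form. -/
noncomputable def enw (P : Matrix V V ℝ) (π g h : V → ℝ) : ℝ :=
  (∑ x, ∑ y, π x * P x y * ((g x - g y) * (h x - h y))) / 2

theorem sym_top [Nonempty V] (A : Matrix V V ℝ) (hA : A.IsHermitian) :
    ∃ (β : ℝ) (f : V → ℝ), f ≠ 0 ∧ A *ᵥ f = β • f ∧ ∀ g, g ⬝ᵥ (A *ᵥ g) ≤ β * (g ⬝ᵥ g) := by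
  have hT := Matrix.isSymmetric_toEuclideanLin_iff.2 hA
  have h := hT.hasEigenvalue_iSup_of_finiteDimensional
  obtain ⟨v, hv⟩ := h.exists_hasEigenvector
  set β : ℝ := ⨆ x : { x : EuclideanSpace ℝ V // x ≠ 0 },
    RCLike.re (inner ℝ (A.toEuclideanLin x) (x : EuclideanSpace ℝ V)) / ‖(x : EuclideanSpace ℝ V)‖ ^ 2 with hβ
  refine ⟨β, v.ofLp, ?_, ?_, ?_⟩
  · intro h0
    apply hv.2
    ext i
    exact congrFun h0 i
  · have := hv.apply_eq_smul
    have h2 := congrArg WithLp.ofLp this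
    simpa using h2
  · intro g
    by_cases hg : g = 0
    · simp [hg]
    have hb : BddAbove (Set.range fun x : { x : EuclideanSpace ℝ V // x ≠ 0 } =>
        RCLike.re (inner ℝ (A.toEuclideanLin x) (x : EuclideanSpace ℝ V)) / ‖(x : EuclideanSpace ℝ V)‖ ^ 2) := by
      refine ⟨‖LinearMap.toContinuousLinearMap A.toEuclideanLin‖, ?_⟩
      rintro _ ⟨x, rfl⟩
      exact (abs_le.1 ((LinearMap.toContinuousLinearMap A.toEuclideanLin).rayleighQuotient_le_norm x)).2
    have hg' : WithLp.toLp 2 g ≠ (0 : EuclideanSpace ℝ V) := by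
      intro h0
      apply hg
      exact congrArg WithLp.ofLp h0
    have hle := le_ciSup hb ⟨WithLp.toLp 2 g, hg'⟩
    have hn : 0 < ‖(WithLp.toLp 2 g : EuclideanSpace ℝ V)‖ ^ 2 := by positivity
    rw [← hβ] at hle
    simp only at hle
    rw [div_le_iff₀ hn, ← real_inner_self_eq_norm_sq] at hle
    have e1 : g ⬝ᵥ (A *ᵥ g) = inner ℝ (A.toEuclideanLin (WithLp.toLp 2 g)) (WithLp.toLp 2 g : EuclideanSpace ℝ V) := by
      simp [EuclideanSpace.inner_eq_star_dotProduct]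
    have e2 : g ⬝ᵥ g = inner ℝ (WithLp.toLp 2 g) (WithLp.toLp 2 g : EuclideanSpace ℝ V) := by
      rw [EuclideanSpace.inner_eq_star_dotProduct]
      simp
    rw [e1, e2]
    exact hle

theorem res_sym (P : Matrix V V ℝ) (π : V → ℝ) (hrev : IsReversible P π) (B : Finset V) (x y : V) :
    π x * res P B x y = π y * res P B y x := by
  unfold res
  by_cases h1 : x ∈ B <;> by_cases h2 : y ∈ B <;> simp [h1, h2, hrev x y]

theorem rev_top [Nonempty V] (P : Matrix V V ℝ) (π : V → ℝ) (hπ : ∀ x, 0 < π x)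
    (hrev : IsReversible P π) (B : Finset V) :
    ∃ f : V → ℝ, f ≠ 0 ∧ res P B *ᵥ f = topEig P B • f ∧
      ∀ g, ipw π g (res P B *ᵥ g) ≤ topEig P B * ipw π g g := by
  set R := res P B with hR
  have hs : ∀ x, 0 < √(π x) := fun x => Real.sqrt_pos.2 (hπ x)
  have hss : ∀ x, √(π x) * √(π x) = π x := fun x => Real.mul_self_sqrt (hπ x).le
  let A : Matrix V V ℝ := fun x y => √(π x) * R x y / √(π y)
  have hA : A.IsHermitian := by
    ext x y
    rw [Matrix.conjTranspose_apply, star_trivial]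
    change √(π y) * R y x / √(π x) = √(π x) * R x y / √(π y)
    rw [div_eq_div_iff (hs x).ne' (hs y).ne']
    have := res_sym P π hrev B x y
    rw [← hss x, ← hss y] at this
    rw [← hR] at this
    linarith
  obtain ⟨β, F, hF, hAF, hmax⟩ := sym_top A hA
  have hkey : ∀ g, ipw π g (R *ᵥ g) ≤ β * ipw π g g := by
    intro g
    have := hmax (fun x => √(π x) * g x)
    have e1 : (fun x => √(π x) * g x) ⬝ᵥ (A *ᵥ (fun x => √(π x) * g x)) = ipw π g (R *ᵥ g) := by
      unfold ipw dotProduct Matrix.mulVec dotProduct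
      refine Finset.sum_congr rfl fun x _ => ?_
      rw [Finset.mul_sum, Finset.mul_sum, Finset.mul_sum]
      refine Finset.sum_congr rfl fun y _ => ?_
      rw [← hss x]
      simp only [A]
      have := (hs y).ne'
      field_simp
    have e2 : (fun x => √(π x) * g x) ⬝ᵥ (fun x => √(π x) * g x) = ipw π g g := by
      unfold ipw dotProduct
      refine Finset.sum_congr rfl fun x _ => ?_
      rw [← hss x]; ring
    rw [e1, e2] at this
    exact this
  have hf : (fun x => F x / √(π x)) ≠ 0 := by
    intro h0
    apply hF
    ext x
    have := congrFun h0 x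
    simpa [(hs x).ne'] using this
  have hRf : R *ᵥ (fun x => F x / √(π x)) = β • (fun x => F x / √(π x)) := by
    ext x
    have := congrFun hAF x
    simp only [Matrix.mulVec, dotProduct, Pi.smul_apply, smul_eq_mul, A] at this ⊢
    rw [← mul_div_assoc, ← this, Finset.sum_div]
    refine Finset.sum_congr rfl fun y _ => ?_
    have h1 := (hs y).ne'
    have h2 := (hs x).ne'
    field_simp
  have hβ : topEig P B = β := by
    apply IsGreatest.csSup_eq
    refine ⟨⟨_, hf, hRf⟩, ?_⟩
    rintro b ⟨f, hf0, hfb⟩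
    have h := hkey f
    rw [hR, hfb] at h
    have e : ipw π f (b • f) = b * ipw π f f := by
      unfold ipw
      rw [Finset.mul_sum]
      refine Finset.sum_congr rfl fun x _ => ?_
      simp; ring
    rw [e] at h
    have hpos : 0 < ipw π f f := by
      obtain ⟨x, hx⟩ := Function.ne_iff.1 hf0
      refine Finset.sum_pos' (fun y _ => mul_nonneg (hπ y).le (mul_self_nonneg _)) ⟨x, Finset.mem_univ _, ?_⟩
      exact mul_pos (hπ x) (mul_self_pos.2 hx)
    exact le_of_mul_le_mul_right h hpos
  rw [hβ]
  exact ⟨_, hf, hRf, hkey⟩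

theorem enw_eq (P : Matrix V V ℝ) (π : V → ℝ) (hP : IsStochastic P) (hrev : IsReversible P π)
    (g h : V → ℝ) : enw P π g h = ipw π g h - ipw π g (P *ᵥ h) := by
  have e1 : ∑ x, ∑ y, π x * P x y * (g x * h x) = ipw π g h := by
    unfold ipw
    refine Finset.sum_congr rfl fun x _ => ?_
    rw [← Finset.sum_mul, ← Finset.mul_sum, hP.2 x, mul_one]
  have e2 : ∑ x, ∑ y, π x * P x y * (g y * h y) = ipw π g h := by
    rw [Finset.sum_comm, ← e1]
    refine Finset.sum_congr rfl fun x _ => Finset.sum_congr rfl fun y _ => ?_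
    rw [hrev]
  have e3 : ∑ x, ∑ y, π x * P x y * (g x * h y) = ipw π g (P *ᵥ h) := by
    unfold ipw Matrix.mulVec dotProduct
    refine Finset.sum_congr rfl fun x _ => ?_
    rw [Finset.mul_sum, Finset.mul_sum]
    refine Finset.sum_congr rfl fun y _ => ?_
    ring
  have e4 : ∑ x, ∑ y, π x * P x y * (g y * h x) = ipw π g (P *ᵥ h) := by
    rw [Finset.sum_comm, ← e3]
    refine Finset.sum_congr rfl fun x _ => Finset.sum_congr rfl fun y _ => ?_
    rw [hrev]
  have : ∑ x, ∑ y, π x * P x y * ((g x - g y) * (h x - h y)) =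
      ipw π g h + ipw π g h - ipw π g (P *ᵥ h) - ipw π g (P *ᵥ h) := by
    rw [← e3]
    nth_rw 2 [e3]
    rw [← e4]
    nth_rw 1 [← e1]
    rw [← e2]
    simp only [← Finset.sum_add_distrib, ← Finset.sum_sub_distrib]
    refine Finset.sum_congr rfl fun x _ => Finset.sum_congr rfl fun y _ => ?_
    ring
  unfold enw
  rw [this]; ring

theorem res_mulVec_of_supp (P : Matrix V V ℝ) (D : Finset V) (h : V → ℝ)
    (hh : ∀ x, x ∉ D → h x = 0) (x : V) (hx : x ∈ D) : (res P D *ᵥ h) x = (P *ᵥ h) x := by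
  unfold Matrix.mulVec dotProduct res
  refine Finset.sum_congr rfl fun y _ => ?_
  by_cases hy : y ∈ D
  · simp [hx, hy]
  · simp [hh y hy]

theorem res_mulVec_off (P : Matrix V V ℝ) (D : Finset V) (h : V → ℝ) (x : V) (hx : x ∉ D) :
    (res P D *ᵥ h) x = 0 := by
  simp [Matrix.mulVec, dotProduct, res, hx]

theorem enw_eq_res (P : Matrix V V ℝ) (π : V → ℝ) (hP : IsStochastic P) (hrev : IsReversible P π)
    (D : Finset V) (g h : V → ℝ) (hg : ∀ x, x ∉ D → g x = 0) (hh : ∀ x, x ∉ D → h x = 0) :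
    enw P π g h = ipw π g h - ipw π g (res P D *ᵥ h) := by
  rw [enw_eq P π hP hrev]
  congr 1
  unfold ipw
  refine Finset.sum_congr rfl fun x _ => ?_
  by_cases hx : x ∈ D
  · rw [res_mulVec_of_supp P D h hh x hx]
  · simp [hg x hx]

theorem ipw_self_pos (π : V → ℝ) (hπ : ∀ x, 0 < π x) (f : V → ℝ) (hf0 : f ≠ 0) : 0 < ipw π f f := by
  obtain ⟨x, hx⟩ := Function.ne_iff.1 hf0
  refine Finset.sum_pos' (fun y _ => mul_nonneg (hπ y).le (mul_self_nonneg _)) ⟨x, Finset.mem_univ _, ?_⟩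
  exact mul_pos (hπ x) (mul_self_pos.2 hx)

/-- A nonnegative near-optimal test function supported on `B`. -/
theorem good_test (P : Matrix V V ℝ) (π : V → ℝ) (hP : IsStochastic P) (hπ : ∀ x, 0 < π x)
    (hrev : IsReversible P π) (B : Finset V) (hB : B.Nonempty) :
    ∃ f : V → ℝ, f ≠ 0 ∧ (∀ x, 0 ≤ f x) ∧ (∀ x, x ∉ B → f x = 0) ∧
      enw P π f f ≤ (1 - topEig P B) * ipw π f f := by
  have : Nonempty V := ⟨hB.choose⟩
  suffices H : ∃ f : V → ℝ, f ≠ 0 ∧ (∀ x, 0 ≤ f x) ∧ (∀ x, x ∉ B → f x = 0) ∧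
      topEig P B * ipw π f f ≤ ipw π f (res P B *ᵥ f) by
    obtain ⟨f, h1, h2, h3, h4⟩ := H
    refine ⟨f, h1, h2, h3, ?_⟩
    rw [enw_eq_res P π hP hrev B f f h3 h3]
    linarith
  have hRn : ∀ x y, 0 ≤ res P B x y := by
    intro x y; unfold res; split_ifs
    · exact hP.1 x y
    · exact le_rfl
  by_cases hβ : topEig P B ≤ 0
  · refine ⟨fun x => if x ∈ B then 1 else 0, ?_, ?_, ?_, ?_⟩
    · intro h0
      obtain ⟨b, hb⟩ := hB
      have := congrFun h0 b
      simp [hb] at this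
    · intro x; dsimp only; split_ifs <;> norm_num
    · intro x hx; simp [hx]
    · refine le_trans (mul_nonpos_of_nonpos_of_nonneg hβ ?_) ?_
      · exact Finset.sum_nonneg fun x _ => mul_nonneg (hπ x).le (mul_self_nonneg _)
      · refine Finset.sum_nonneg fun x _ => mul_nonneg (hπ x).le (mul_nonneg ?_ ?_)
        · dsimp only; split_ifs <;> norm_num
        · refine Finset.sum_nonneg fun y _ => mul_nonneg (hRn _ _) ?_
          dsimp only; split_ifs <;> norm_num
  · push Not at hβ
    obtain ⟨f, hf, hRf, -⟩ := rev_top P π hπ hrev B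
    refine ⟨fun x => |f x|, ?_, fun x => abs_nonneg _, ?_, ?_⟩
    · intro h0
      apply hf
      ext x
      simpa using congrFun h0 x
    · intro x hx
      have := congrFun hRf x
      rw [res_mulVec_off P B f x hx] at this
      simp only [Pi.smul_apply, smul_eq_mul] at this
      rcases mul_eq_zero.1 this.symm with h | h
      · exact absurd h hβ.ne'
      · simp [h]
    · unfold ipw
      rw [Finset.mul_sum]
      refine Finset.sum_le_sum fun x _ => ?_
      have h1 : |topEig P B * f x| ≤ (res P B *ᵥ fun x => |f x|) x := by
        have := congrFun hRf x
        simp only [Pi.smul_apply, smul_eq_mul] at this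
        rw [← this]
        unfold Matrix.mulVec dotProduct
        refine (Finset.abs_sum_le_sum_abs _ _).trans (Finset.sum_le_sum fun y _ => ?_)
        rw [abs_mul, abs_of_nonneg (hRn x y)]
      rw [abs_mul, abs_of_pos hβ] at h1
      have h2 := mul_le_mul_of_nonneg_left h1 (mul_nonneg (hπ x).le (abs_nonneg (f x)))
      nlinarith [h2]

theorem pow_nonneg_mat (P : Matrix V V ℝ) (hP : ∀ x y, 0 ≤ P x y) (n : ℕ) : ∀ x y, 0 ≤ (P ^ n) x y := by
  induction n with
  | zero => intro x y; rw [pow_zero, Matrix.one_apply]; split_ifs <;> norm_num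
  | succ n ih =>
    intro x y
    rw [pow_succ, Matrix.mul_apply]
    exact Finset.sum_nonneg fun z _ => mul_nonneg (ih x z) (hP z y)

theorem gap_pos (P : Matrix V V ℝ) (π : V → ℝ) (hP : IsStochastic P) (hirr : IsIrreducibleMat P)
    (hπ : ∀ x, 0 < π x)
    (hrev : IsReversible P π) (B : Finset V) (hB : B.Nonempty) (hB' : B ≠ Finset.univ) :
    topEig P B < 1 := by
  by_contra hcon
  push Not at hcon
  obtain ⟨f, hf, -, hsupp, hE⟩ := good_test P π hP hπ hrev B hB
  have hE0 : enw P π f f ≤ 0 :=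
    hE.trans (mul_nonpos_of_nonpos_of_nonneg (by linarith) (ipw_self_pos π hπ f hf).le)
  have hterm : ∀ x y, 0 ≤ π x * P x y * ((f x - f y) * (f x - f y)) := fun x y =>
    mul_nonneg (mul_nonneg (hπ x).le (hP.1 x y)) (mul_self_nonneg _)
  have hsum : ∑ x, ∑ y, π x * P x y * ((f x - f y) * (f x - f y)) = 0 := by
    apply le_antisymm
    · unfold enw at hE0; linarith
    · exact Finset.sum_nonneg fun x _ => Finset.sum_nonneg fun y _ => hterm x y
  have hedge : ∀ x y, 0 < P x y → f x = f y := by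
    intro x y hxy
    have h1 := (Finset.sum_eq_zero_iff_of_nonneg
      (fun x _ => Finset.sum_nonneg fun y _ => hterm x y)).1 hsum x (Finset.mem_univ _)
    have h2 := (Finset.sum_eq_zero_iff_of_nonneg (fun y _ => hterm x y)).1 h1 y (Finset.mem_univ _)
    have h3 := (mul_pos (hπ x) hxy).ne'
    have h4 := (mul_eq_zero.1 h2).resolve_left h3
    have := mul_self_eq_zero.1 h4
    linarith
  have hpath : ∀ n : ℕ, ∀ x y, 0 < (P ^ n) x y → f x = f y := by
    intro n
    induction n with
    | zero =>
      intro x y h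
      rw [pow_zero, Matrix.one_apply] at h
      split_ifs at h with hxy
      · rw [hxy]
      · exact absurd h (lt_irrefl _)
    | succ n ih =>
      intro x y h
      rw [pow_succ, Matrix.mul_apply] at h
      obtain ⟨z, -, hz⟩ := Finset.exists_ne_zero_of_sum_ne_zero h.ne'
      have hz1 := (pow_nonneg_mat P hP.1 n x z).lt_of_ne' (left_ne_zero_of_mul hz)
      have hz2 := (hP.1 z y).lt_of_ne' (right_ne_zero_of_mul hz)
      rw [ih x z hz1, hedge z y hz2]
  obtain ⟨z, hz⟩ : ∃ z, z ∉ B := by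
    by_contra h; push Not at h
    exact hB' (Finset.eq_univ_iff_forall.2 h)
  apply hf
  ext x
  obtain ⟨n, hn⟩ := hirr x z
  rw [hpath n x z hn, hsupp z hz]; rfl

theorem poincare (P : Matrix V V ℝ) (π : V → ℝ) (hP : IsStochastic P) (hπ : ∀ x, 0 < π x)
    (hrev : IsReversible P π) (B : Finset V) (hB : B.Nonempty) (g : V → ℝ)
    (hg : ∀ x, x ∉ B → g x = 0) : (1 - topEig P B) * ipw π g g ≤ enw P π g g := by
  have : Nonempty V := ⟨hB.choose⟩
  obtain ⟨f, -, -, h⟩ := rev_top P π hπ hrev B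
  rw [enw_eq_res P π hP hrev B g g hg hg]
  linarith [h g]

theorem enw_cs (P : Matrix V V ℝ) (π : V → ℝ) (hP : IsStochastic P) (hπ : ∀ x, 0 < π x)
    (g h : V → ℝ) : enw P π g h ^ 2 ≤ enw P π g g * enw P π h h := by
  have hw : ∀ x y, 0 ≤ π x * P x y := fun x y => mul_nonneg (hπ x).le (hP.1 x y)
  have := Finset.sum_sq_le_sum_mul_sum_of_sq_le_mul (Finset.univ : Finset (V × V))
    (r := fun p => π p.1 * P p.1 p.2 * ((g p.1 - g p.2) * (h p.1 - h p.2)))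
    (f := fun p => π p.1 * P p.1 p.2 * ((g p.1 - g p.2) * (g p.1 - g p.2)))
    (g := fun p => π p.1 * P p.1 p.2 * ((h p.1 - h p.2) * (h p.1 - h p.2)))
    (fun p _ => mul_nonneg (hw _ _) (mul_self_nonneg _))
    (fun p _ => mul_nonneg (hw _ _) (mul_self_nonneg _))
    (fun p _ => le_of_eq (by ring))
  simp only [Fintype.sum_prod_type] at this
  unfold enw
  nlinarith [this]


/-- Indicator of `D`. -/
def indw (D : Finset V) : V → ℝ := fun x => if x ∈ D then 1 else 0

/-- Survival functions. -/
def survw (P : Matrix V V ℝ) (D : Finset V) (n : ℕ) : V → ℝ := (res P D ^ n) *ᵥ indw D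

theorem res_nonneg (P : Matrix V V ℝ) (hP : IsStochastic P) (D : Finset V) : ∀ x y, 0 ≤ res P D x y := by
  intro x y; unfold res; split_ifs
  · exact hP.1 x y
  · exact le_rfl

theorem indw_nonneg (D : Finset V) (x : V) : 0 ≤ indw D x := by
  unfold indw; split_ifs <;> norm_num

theorem survw_nonneg (P : Matrix V V ℝ) (hP : IsStochastic P) (D : Finset V) (n : ℕ) (x : V) :
    0 ≤ survw P D n x :=
  Finset.sum_nonneg fun y _ => mul_nonneg (pow_nonneg_mat _ (res_nonneg P hP D) n x y) (indw_nonneg D y)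

theorem survw_succ (P : Matrix V V ℝ) (D : Finset V) (n : ℕ) :
    survw P D (n + 1) = res P D *ᵥ survw P D n := by
  unfold survw
  rw [pow_succ', Matrix.mulVec_mulVec]

theorem survw_off (P : Matrix V V ℝ) (D : Finset V) (n : ℕ) (x : V) (hx : x ∉ D) :
    survw P D n x = 0 := by
  cases n with
  | zero => simp [survw, indw, hx]
  | succ n => rw [survw_succ]; exact res_mulVec_off P D _ x hx

theorem survw_one (P : Matrix V V ℝ) (D : Finset V) (n : ℕ) (x : V) (hx : x ∈ D) :
    ∑ y, (res P D ^ n) x y = survw P D n x := by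
  have h1 : ∑ y, (res P D ^ n) x y = ((res P D ^ n) *ᵥ (fun _ => 1)) x := by
    simp [Matrix.mulVec, dotProduct]
  rw [h1]
  cases n with
  | zero => simp [survw, indw, hx]
  | succ n =>
    unfold survw
    rw [pow_succ, ← Matrix.mulVec_mulVec, ← Matrix.mulVec_mulVec]
    have : (res P D *ᵥ fun _ => (1 : ℝ)) = res P D *ᵥ indw D := by
      ext z
      unfold Matrix.mulVec dotProduct
      refine Finset.sum_congr rfl fun y _ => ?_
      by_cases hy : y ∈ D <;> simp [indw, res, hy]
    rw [this]

theorem survGT_eq (P : Matrix V V ℝ) (π : V → ℝ) (D : Finset V) (m : ℕ) :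
    survGT P (condOn π D) D m = ipw π (indw D) (survw P D m) / (∑ b ∈ D, π b) := by
  unfold survGT ipw
  rw [Finset.sum_div]
  refine Finset.sum_congr rfl fun x _ => ?_
  rw [← Finset.mul_sum]
  by_cases hx : x ∈ D
  · rw [survw_one P D m x hx]
    simp [condOn, indw, hx]
    ring
  · simp [condOn, indw, hx]

theorem ipw_comm (π g h : V → ℝ) : ipw π g h = ipw π h g :=
  Finset.sum_congr rfl fun x _ => by rw [mul_comm (g x)]

theorem ipw_sub (π g h k : V → ℝ) : ipw π g (h - k) = ipw π g h - ipw π g k := by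
  unfold ipw
  rw [← Finset.sum_sub_distrib]
  exact Finset.sum_congr rfl fun x _ => by simp; ring

theorem ipw_sum (π g : V → ℝ) (u : ℕ → V → ℝ) (n : ℕ) :
    ipw π g (∑ m ∈ Finset.range n, u m) = ∑ m ∈ Finset.range n, ipw π g (u m) := by
  unfold ipw
  rw [Finset.sum_comm]
  refine Finset.sum_congr rfl fun x _ => ?_
  rw [Finset.sum_apply, Finset.mul_sum, Finset.mul_sum]

theorem ipw_nonneg (π g h : V → ℝ) (hπ : ∀ x, 0 < π x) (hg : ∀ x, 0 ≤ g x) (hh : ∀ x, 0 ≤ h x) :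
    0 ≤ ipw π g h :=
  Finset.sum_nonneg fun x _ => mul_nonneg (hπ x).le (mul_nonneg (hg x) (hh x))

theorem ipw_cs (π g h : V → ℝ) (hπ : ∀ x, 0 < π x) : ipw π g h ^ 2 ≤ ipw π g g * ipw π h h :=
  Finset.sum_sq_le_sum_mul_sum_of_sq_le_mul Finset.univ
    (fun x _ => mul_nonneg (hπ x).le (mul_self_nonneg _))
    (fun x _ => mul_nonneg (hπ x).le (mul_self_nonneg _))
    (fun x _ => le_of_eq (by ring))

theorem ipw_indw (π : V → ℝ) (D : Finset V) (h : V → ℝ) :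
    ipw π (indw D) h = ∑ x ∈ D, π x * h x := by
  unfold ipw indw
  simp [Finset.sum_ite_mem]

theorem green (P : Matrix V V ℝ) (D : Finset V) (n : ℕ) :
    res P D *ᵥ (∑ m ∈ Finset.range n, survw P D m) =
      (∑ m ∈ Finset.range n, survw P D m) - (indw D - survw P D n) := by
  induction n with
  | zero => simp [survw]
  | succ n ih =>
    rw [Finset.sum_range_succ, Matrix.mulVec_add, ih, ← survw_succ]
    abel

theorem sum_off (P : Matrix V V ℝ) (D : Finset V) (n : ℕ) (x : V) (hx : x ∉ D) :
    (∑ m ∈ Finset.range n, survw P D m) x = 0 := by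
  rw [Finset.sum_apply]
  exact Finset.sum_eq_zero fun m _ => survw_off P D m x hx

theorem enw_green (P : Matrix V V ℝ) (π : V → ℝ) (hP : IsStochastic P) (hrev : IsReversible P π)
    (D : Finset V) (n : ℕ) (g : V → ℝ) (hg : ∀ x, x ∉ D → g x = 0) :
    enw P π g (∑ m ∈ Finset.range n, survw P D m) = ipw π g (indw D) - ipw π g (survw P D n) := by
  rw [enw_eq_res P π hP hrev D g _ hg (sum_off P D n), green, ipw_sub, ipw_sub]
  ring

theorem enw_green_le (P : Matrix V V ℝ) (π : V → ℝ) (hP : IsStochastic P) (hπ : ∀ x, 0 < π x)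
    (hrev : IsReversible P π) (D : Finset V) (n : ℕ) :
    enw P π (∑ m ∈ Finset.range n, survw P D m) (∑ m ∈ Finset.range n, survw P D m) ≤
      ∑ m ∈ Finset.range n, ipw π (indw D) (survw P D m) := by
  rw [enw_green P π hP hrev D n _ (sum_off P D n), ← ipw_sum, ipw_comm π _ (indw D)]
  have : 0 ≤ ipw π (∑ m ∈ Finset.range n, survw P D m) (survw P D n) := by
    refine ipw_nonneg π _ _ hπ (fun x => ?_) (survw_nonneg P hP D n)
    rw [Finset.sum_apply]
    exact Finset.sum_nonneg fun m _ => survw_nonneg P hP D m x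
  linarith

theorem partial_le (P : Matrix V V ℝ) (π : V → ℝ) (hP : IsStochastic P) (hπ : ∀ x, 0 < π x)
    (hrev : IsReversible P π) (B : Finset V) (hB : B.Nonempty) (hlam : topEig P B < 1)
    (D : Finset V) (hD : D ⊆ B) (n : ℕ) :
    ∑ m ∈ Finset.range n, ipw π (indw D) (survw P D m) ≤ (∑ b ∈ D, π b) * (1 - topEig P B)⁻¹ := by
  have h1 := poincare P π hP hπ hrev B hB (∑ m ∈ Finset.range n, survw P D m)
    (fun x hx => sum_off P D n x (fun h => hx (hD h)))
  have h2 := enw_green_le P π hP hπ hrev D n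
  have h3 := ipw_cs π (indw D) (∑ m ∈ Finset.range n, survw P D m) hπ
  have h4 : ipw π (indw D) (indw D) = ∑ b ∈ D, π b := by
    rw [ipw_indw]
    exact Finset.sum_congr rfl fun x hx => by simp [indw, hx]
  rw [h4, ipw_sum] at h3
  set s := ∑ m ∈ Finset.range n, ipw π (indw D) (survw P D m)
  set q := ipw π (∑ m ∈ Finset.range n, survw P D m) (∑ m ∈ Finset.range n, survw P D m)
  have hp : 0 ≤ ∑ b ∈ D, π b := Finset.sum_nonneg fun b _ => (hπ b).le
  have hl : 0 < 1 - topEig P B := by linarith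
  rw [← div_eq_mul_inv, le_div_iff₀ hl]
  by_contra hcon
  push Not at hcon
  have h5 : (1 - topEig P B) * q ≤ s := h1.trans h2
  have hs : 0 < s := by
    by_contra hs
    push Not at hs
    nlinarith
  have h6 := mul_le_mul_of_nonneg_left h5 hp
  have h7 := mul_le_mul_of_nonneg_right h3 hl.le
  nlinarith

theorem summ_surv (P : Matrix V V ℝ) (π : V → ℝ) (hP : IsStochastic P) (hπ : ∀ x, 0 < π x)
    (hrev : IsReversible P π) (B : Finset V) (hB : B.Nonempty) (hlam : topEig P B < 1)
    (D : Finset V) (hD : D ⊆ B) : Summable fun m => ipw π (indw D) (survw P D m) :=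
  summable_of_sum_range_le
    (fun m => ipw_nonneg π _ _ hπ (indw_nonneg D) (survw_nonneg P hP D m))
    (partial_le P π hP hπ hrev B hB hlam D hD)

theorem expExit_eq (P : Matrix V V ℝ) (π : V → ℝ) (hπ : ∀ x, 0 < π x)
    (D : Finset V) (hD : D.Nonempty) :
    (∑ b ∈ D, π b) * expExit P (condOn π D) D = ∑' m, ipw π (indw D) (survw P D m) := by
  unfold expExit
  simp_rw [survGT_eq]
  rw [tsum_div_const]
  have : 0 < ∑ b ∈ D, π b := Finset.sum_pos (fun b _ => hπ b) hD
  field_simp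

theorem upper (P : Matrix V V ℝ) (π : V → ℝ) (hP : IsStochastic P) (hπ : ∀ x, 0 < π x)
    (hrev : IsReversible P π) (B : Finset V) (hB : B.Nonempty) (hlam : topEig P B < 1)
    (D : Finset V) (hD : D ⊆ B) (hD' : D.Nonempty) :
    expExit P (condOn π D) D ≤ (1 - topEig P B)⁻¹ := by
  have : 0 < ∑ b ∈ D, π b := Finset.sum_pos (fun b _ => hπ b) hD'
  refine le_of_mul_le_mul_left ?_ this
  rw [expExit_eq P π hπ D hD']
  exact Real.tsum_le_of_sum_range_le
    (fun m => ipw_nonneg π _ _ hπ (indw_nonneg D) (survw_nonneg P hP D m))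
    (partial_le P π hP hπ hrev B hB hlam D hD)

theorem torsion (P : Matrix V V ℝ) (π : V → ℝ) (hP : IsStochastic P) (hπ : ∀ x, 0 < π x)
    (hrev : IsReversible P π) (B : Finset V) (hB : B.Nonempty) (hlam : topEig P B < 1)
    (D : Finset V) (hD : D ⊆ B) (hD' : D.Nonempty) (g : V → ℝ) (hg : ∀ x, x ∉ D → g x = 0) :
    ipw π g (indw D) ^ 2 ≤ (∑ b ∈ D, π b) * expExit P (condOn π D) D * enw P π g g := by
  have hsum := summ_surv P π hP hπ hrev B hB hlam D hD
  have hu0 : ∀ x ∈ D, Filter.Tendsto (fun n => survw P D n x) Filter.atTop (nhds 0) := by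
    intro x hx
    have h1 := (hsum.tendsto_atTop_zero).div_const (π x)
    rw [zero_div] at h1
    refine squeeze_zero (fun n => survw_nonneg P hP D n x) (fun n => ?_) h1
    rw [le_div_iff₀ (hπ x), ipw_indw, mul_comm]
    exact Finset.single_le_sum (f := fun x => π x * survw P D n x)
      (fun y _ => mul_nonneg (hπ y).le (survw_nonneg P hP D n y)) hx
  have hg0 : Filter.Tendsto (fun n => ipw π g (survw P D n)) Filter.atTop (nhds 0) := by
    have : (0 : ℝ) = ∑ x : V, 0 := by simp
    rw [this]
    refine tendsto_finsetSum _ fun x _ => ?_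
    by_cases hx : x ∈ D
    · have := ((hu0 x hx).const_mul (g x)).const_mul (π x)
      simpa using this
    · simp [hg x hx]
  have hlim : Filter.Tendsto (fun n => (ipw π g (indw D) - ipw π g (survw P D n)) ^ 2)
      Filter.atTop (nhds (ipw π g (indw D) ^ 2)) := by
    have := (hg0.const_sub (ipw π g (indw D))).pow 2
    simpa using this
  refine le_of_tendsto' hlim fun n => ?_
  rw [← enw_green P π hP hrev D n g hg]
  refine (enw_cs P π hP hπ _ _).trans ?_
  rw [mul_comm, expExit_eq P π hπ D hD']
  refine mul_le_mul_of_nonneg_right ((enw_green_le P π hP hπ hrev D n).trans ?_) ?_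
  · exact hsum.sum_le_tsum _ (fun m _ => ipw_nonneg π _ _ hπ (indw_nonneg D) (survw_nonneg P hP D m))
  · refine div_nonneg (Finset.sum_nonneg fun x _ => Finset.sum_nonneg fun y _ => ?_) (by norm_num)
    exact mul_nonneg (mul_nonneg (hπ x).le (hP.1 x y)) (mul_self_nonneg _)


theorem enw_smul (P : Matrix V V ℝ) (π : V → ℝ) (c : ℝ) (f : V → ℝ) :
    enw P π (fun x => c * f x) (fun x => c * f x) = c ^ 2 * enw P π f f := by
  unfold enw
  rw [← mul_div_assoc, Finset.mul_sum]
  congr 1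
  refine Finset.sum_congr rfl fun x _ => ?_
  rw [Finset.mul_sum]
  refine Finset.sum_congr rfl fun y _ => ?_
  ring

theorem ipw_smul (π : V → ℝ) (c : ℝ) (f : V → ℝ) :
    ipw π (fun x => c * f x) (fun x => c * f x) = c ^ 2 * ipw π f f := by
  unfold ipw
  rw [Finset.mul_sum]
  refine Finset.sum_congr rfl fun x _ => ?_
  ring

/-- Dyadic truncation. -/
noncomputable def trw (k : ℕ) (t : ℝ) : ℝ := min t (2 ^ (k + 1)) - min t (2 ^ k)

theorem trw_nonneg (k : ℕ) (t : ℝ) : 0 ≤ trw k t := by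
  unfold trw
  have : (2 : ℝ) ^ k ≤ 2 ^ (k + 1) := pow_le_pow_right₀ (by norm_num) (by omega)
  linarith [min_le_min_left t this]

theorem trw_zero (k : ℕ) (t : ℝ) (h : t ≤ 2 ^ k) : trw k t = 0 := by
  unfold trw
  have : (2 : ℝ) ^ k ≤ 2 ^ (k + 1) := pow_le_pow_right₀ (by norm_num) (by omega)
  rw [min_eq_left h, min_eq_left (h.trans this)]; ring

theorem trw_full (k : ℕ) (t : ℝ) (h : 2 ^ (k + 1) < t) : trw k t = 2 ^ k := by
  unfold trw
  have : (2 : ℝ) ^ k ≤ 2 ^ (k + 1) := pow_le_pow_right₀ (by norm_num) (by omega)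
  rw [min_eq_right h.le, min_eq_right (this.trans h.le)]; ring

theorem trw_sq_aux (s t : ℝ) (hst : s ≤ t) (K : ℕ) :
    ∑ k ∈ Finset.range K, (trw k t - trw k s) * (trw k t - trw k s) ≤
      (min t (2 ^ K) - min s (2 ^ K)) ^ 2 := by
  induction K with
  | zero => simp only [Finset.range_zero, Finset.sum_empty]; positivity
  | succ K ih =>
    rw [Finset.sum_range_succ]
    have h1 : 0 ≤ min t (2 ^ K) - min s (2 ^ K) := by
      linarith [min_le_min_right ((2 : ℝ) ^ K) hst]
    have h2 : 0 ≤ trw K t - trw K s := by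
      have hp : (0 : ℝ) < 2 ^ K := by positivity
      have e : (2 : ℝ) ^ (K + 1) = 2 * 2 ^ K := by ring
      unfold trw
      rw [e]
      rcases le_total s (2 ^ K) with a | a <;> rcases le_total t (2 ^ K) with b | b <;>
      rcases le_total s (2 * 2 ^ K) with c | c <;> rcases le_total t (2 * 2 ^ K) with d | d <;>
      simp only [min_eq_left, min_eq_right, a, b, c, d] <;> linarith
    have h3 : min t (2 ^ (K + 1)) - min s (2 ^ (K + 1)) =
        (min t (2 ^ K) - min s (2 ^ K)) + (trw K t - trw K s) := by unfold trw; ring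
    rw [h3]
    nlinarith [mul_nonneg h1 h2]

theorem trw_sq (s t : ℝ) (K : ℕ) :
    ∑ k ∈ Finset.range K, (trw k t - trw k s) * (trw k t - trw k s) ≤ (t - s) * (t - s) := by
  wlog hst : s ≤ t generalizing s t
  · have := this t s (by linarith)
    calc _ = ∑ k ∈ Finset.range K, (trw k s - trw k t) * (trw k s - trw k t) :=
          Finset.sum_congr rfl fun k _ => by ring
      _ ≤ _ := this
      _ = _ := by ring
  refine (trw_sq_aux s t hst K).trans ?_
  rw [← pow_two]
  have h1 : 0 ≤ min t (2 ^ K) - min s (2 ^ K) := by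
    linarith [min_le_min_right ((2 : ℝ) ^ K) hst]
  refine pow_le_pow_left₀ h1 ?_ 2
  rcases le_total s (2 ^ K) with a | a <;> rcases le_total t (2 ^ K) with b | b <;>
    simp only [min_eq_left, min_eq_right, a, b] <;> linarith

theorem sum_enw_le (P : Matrix V V ℝ) (π : V → ℝ) (hP : IsStochastic P) (hπ : ∀ x, 0 < π x)
    (f : V → ℝ) (K : ℕ) :
    ∑ k ∈ Finset.range K, enw P π (fun x => trw k (f x)) (fun x => trw k (f x)) ≤ enw P π f f := by
  unfold enw
  rw [← Finset.sum_div]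
  refine div_le_div_of_nonneg_right ?_ (by norm_num)
  rw [Finset.sum_comm]
  refine Finset.sum_le_sum fun x _ => ?_
  rw [Finset.sum_comm]
  refine Finset.sum_le_sum fun y _ => ?_
  rw [← Finset.mul_sum]
  exact mul_le_mul_of_nonneg_left (trw_sq (f y) (f x) K) (mul_nonneg (hπ x).le (hP.1 x y))

theorem layer (t : ℝ) (ht : t = 0 ∨ 2 < t) (K : ℕ) (hK : t ≤ 2 ^ (K + 1)) :
    t * t ≤ 4 * ∑ k ∈ Finset.range K, (4 : ℝ) ^ (k + 1) * (if 2 ^ (k + 1) < t then 1 else 0) := by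
  induction K with
  | zero =>
    rcases ht with h | h
    · simp [h]
    · norm_num at hK; linarith
  | succ K ih =>
    rw [Finset.sum_range_succ]
    by_cases h : t ≤ 2 ^ (K + 1)
    · have := ih h
      rw [if_neg (not_lt.2 h)]
      linarith
    · push Not at h
      rw [if_pos h]
      have h0 : 0 ≤ ∑ k ∈ Finset.range K, (4 : ℝ) ^ (k + 1) * (if 2 ^ (k + 1) < t then 1 else 0) :=
        Finset.sum_nonneg fun k _ => mul_nonneg (by positivity) (by split_ifs <;> norm_num)
      have ht0 : 0 ≤ t := le_trans (by positivity) h.le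
      have h1 := mul_le_mul hK hK ht0 (by positivity)
      have h2 : (2 : ℝ) ^ (K + 1 + 1) * 2 ^ (K + 1 + 1) = 4 * 4 ^ (K + 1) := by
        rw [← mul_pow]; norm_num; ring
      linarith

/-- Level masses. -/
noncomputable def lvl (π f : V → ℝ) (k : ℕ) : ℝ := ∑ x, π x * (if 2 ^ k < f x then 1 else 0)

theorem lvl_eq (π f : V → ℝ) (k : ℕ) :
    lvl π f k = ∑ x ∈ Finset.univ.filter (fun x => 2 ^ k < f x), π x := by
  unfold lvl
  rw [Finset.sum_filter]
  exact Finset.sum_congr rfl fun x _ => by split_ifs <;> simp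

theorem lvl_nonneg (π f : V → ℝ) (hπ : ∀ x, 0 < π x) (k : ℕ) : 0 ≤ lvl π f k :=
  Finset.sum_nonneg fun x _ => mul_nonneg (hπ x).le (by split_ifs <;> norm_num)

theorem lvl_step (P : Matrix V V ℝ) (π : V → ℝ) (hP : IsStochastic P) (hπ : ∀ x, 0 < π x)
    (hrev : IsReversible P π) (B : Finset V) (hB : B.Nonempty) (hlam : topEig P B < 1)
    (M : ℝ) (hM0 : 0 ≤ M)
    (hM : ∀ D : Finset V, D ⊆ B → D.Nonempty → expExit P (condOn π D) D ≤ M)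
    (f : V → ℝ) (hsupp : ∀ x, x ∉ B → f x = 0) (k : ℕ) :
    4 ^ (k + 1) * lvl π f (k + 1) ≤ 4 ^ k * lvl π f k / 2 +
      8 * M * enw P π (fun x => trw k (f x)) (fun x => trw k (f x)) := by
  have hE : 0 ≤ enw P π (fun x => trw k (f x)) (fun x => trw k (f x)) := by
    refine div_nonneg (Finset.sum_nonneg fun x _ => Finset.sum_nonneg fun y _ => ?_) (by norm_num)
    exact mul_nonneg (mul_nonneg (hπ x).le (hP.1 x y)) (mul_self_nonneg _)
  have hp2 : (2 : ℝ) ^ k ≤ 2 ^ (k + 1) := pow_le_pow_right₀ (by norm_num) (by omega)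
  have hmono : lvl π f (k + 1) ≤ lvl π f k := by
    refine Finset.sum_le_sum fun x _ => mul_le_mul_of_nonneg_left ?_ (hπ x).le
    split_ifs with h1 h2
    · exact le_rfl
    · exact absurd (hp2.trans_lt h1) h2
    · norm_num
    · norm_num
  have ha0 := lvl_nonneg π f hπ k
  have ha1 := lvl_nonneg π f hπ (k + 1)
  set D := Finset.univ.filter (fun x => 2 ^ k < f x) with hDdef
  by_cases hD : D.Nonempty
  · have hDB : D ⊆ B := by
      intro x hx
      by_contra hxB
      rw [hDdef, Finset.mem_filter, hsupp x hxB] at hx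
      have : (0 : ℝ) < 2 ^ k := by positivity
      linarith [hx.2]
    have ht := torsion P π hP hπ hrev B hB hlam D hDB hD (fun x => trw k (f x)) (by
      intro x hx
      apply trw_zero
      by_contra h
      push Not at h
      exact hx (by simp [hDdef, h]))
    rw [hDdef, ← lvl_eq, ← hDdef] at ht
    have hlow : 2 ^ k * lvl π f (k + 1) ≤ ipw π (fun x => trw k (f x)) (indw D) := by
      unfold lvl ipw
      rw [Finset.mul_sum]
      refine Finset.sum_le_sum fun x _ => ?_
      split_ifs with h
      · have hx : x ∈ D := by simp [hDdef]; linarith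
        simp only [indw, hx, if_true]
        rw [trw_full k _ h]; linarith
      · simp only [mul_zero]
        exact mul_nonneg (hπ x).le (mul_nonneg (trw_nonneg _ _) (indw_nonneg _ _))
    set e := enw P π (fun x => trw k (f x)) (fun x => trw k (f x))
    have h1 : (2 ^ k * lvl π f (k + 1)) ^ 2 ≤ lvl π f k * M * e := by
      refine (pow_le_pow_left₀ (by positivity) hlow 2).trans (ht.trans ?_)
      exact mul_le_mul_of_nonneg_right (mul_le_mul_of_nonneg_left (hM D hDB hD) ha0) hE
    have e4 : (4 : ℝ) ^ k = 2 ^ k * 2 ^ k := by rw [← mul_pow]; norm_num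
    refine abs_le_of_sq_le_sq' ?_ (by positivity) |>.2
    have hq : (0 : ℝ) ≤ 4 ^ k := by positivity
    have h2 := mul_le_mul_of_nonneg_left h1 (mul_nonneg (by norm_num : (0 : ℝ) ≤ 16) hq)
    have e5 : (4 ^ (k + 1) * lvl π f (k + 1)) ^ 2 = 16 * 4 ^ k * (2 ^ k * lvl π f (k + 1)) ^ 2 := by
      rw [pow_succ (4 : ℝ) k, e4]; ring
    rw [e5]
    nlinarith [sq_nonneg (4 ^ k * lvl π f k / 2 - 8 * M * e)]
  · have h0 : lvl π f k = 0 := by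
      rw [lvl_eq, ← hDdef, Finset.not_nonempty_iff_eq_empty.1 hD, Finset.sum_empty]
    have h1 : lvl π f (k + 1) = 0 := by linarith
    rw [h0, h1]
    have : 0 ≤ 8 * M * enw P π (fun x => trw k (f x)) (fun x => trw k (f x)) := by positivity
    linarith

theorem faber (P : Matrix V V ℝ) (π : V → ℝ) (hP : IsStochastic P) (hπ : ∀ x, 0 < π x)
    (hrev : IsReversible P π) (B : Finset V) (hB : B.Nonempty) (hlam : topEig P B < 1)
    (M : ℝ) (hM0 : 0 ≤ M)
    (hM : ∀ D : Finset V, D ⊆ B → D.Nonempty → expExit P (condOn π D) D ≤ M)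
    (f : V → ℝ) (hsupp : ∀ x, x ∉ B → f x = 0) (hf : ∀ x, f x = 0 ∨ 2 < f x) :
    3 * ipw π f f ≤ 256 * M * enw P π f f := by
  obtain ⟨K, hK0, hK⟩ : ∃ K : ℕ, 0 < K ∧ ∀ x, f x ≤ 2 ^ (K + 1) := by
    obtain ⟨N, hN⟩ := pow_unbounded_of_one_lt (∑ x, |f x|) (by norm_num : (1 : ℝ) < 2)
    refine ⟨N + 1, by omega, fun x => ?_⟩
    have h1 : |f x| ≤ ∑ x, |f x| :=
      Finset.single_le_sum (f := fun x => |f x|) (fun y _ => abs_nonneg _) (Finset.mem_univ x)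
    have h2 : (2 : ℝ) ^ N ≤ 2 ^ (N + 1 + 1) := pow_le_pow_right₀ (by norm_num) (by omega)
    linarith [le_abs_self (f x)]
  set a : ℕ → ℝ := fun k => 4 ^ k * lvl π f k with ha
  have han : ∀ k, 0 ≤ a k := fun k => mul_nonneg (by positivity) (lvl_nonneg π f hπ k)
  have h1 : ipw π f f ≤ 4 * ∑ k ∈ Finset.range K, a (k + 1) := by
    have : ∑ k ∈ Finset.range K, a (k + 1) = ∑ x, π x *
        ∑ k ∈ Finset.range K, (4 : ℝ) ^ (k + 1) * (if 2 ^ (k + 1) < f x then 1 else 0) := by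
      simp only [ha, lvl, Finset.mul_sum]
      rw [Finset.sum_comm]
      refine Finset.sum_congr rfl fun x _ => Finset.sum_congr rfl fun k _ => ?_
      ring
    rw [this, Finset.mul_sum]
    refine Finset.sum_le_sum fun x _ => ?_
    have := mul_le_mul_of_nonneg_left (layer (f x) (hf x) K (hK x)) (hπ x).le
    linarith
  have h2 : ∑ k ∈ Finset.range K, a (k + 1) ≤ (∑ k ∈ Finset.range K, a k) / 2 +
      8 * M * enw P π f f := by
    calc _ ≤ ∑ k ∈ Finset.range K, (a k / 2 +
          8 * M * enw P π (fun x => trw k (f x)) (fun x => trw k (f x))) :=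
          Finset.sum_le_sum fun k _ => lvl_step P π hP hπ hrev B hB hlam M hM0 hM f hsupp k
      _ = (∑ k ∈ Finset.range K, a k) / 2 + 8 * M *
          ∑ k ∈ Finset.range K, enw P π (fun x => trw k (f x)) (fun x => trw k (f x)) := by
          rw [Finset.sum_add_distrib, Finset.sum_div, Finset.mul_sum]
      _ ≤ _ := by
          have := mul_le_mul_of_nonneg_left (sum_enw_le P π hP hπ f K)
            (mul_nonneg (by norm_num : (0 : ℝ) ≤ 8) hM0)
          linarith
  have h3 : ∑ k ∈ Finset.range K, a k ≤ a 0 + ∑ k ∈ Finset.range K, a (k + 1) := by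
    have e1 := Finset.sum_range_succ a K
    have e2 := Finset.sum_range_succ' a K
    linarith [han K]
  have h4 : a 1 ≤ ∑ k ∈ Finset.range K, a (k + 1) :=
    Finset.single_le_sum (f := fun k => a (k + 1)) (fun k _ => han _) (Finset.mem_range.2 hK0)
  have h5 : 4 * a 0 ≤ a 1 := by
    have : lvl π f 0 ≤ lvl π f 1 := by
      refine Finset.sum_le_sum fun x _ => mul_le_mul_of_nonneg_left ?_ (hπ x).le
      rcases hf x with h | h
      · rw [h]; norm_num
      · have h' : (1 : ℝ) < f x := by linarith
        simp [h, h']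
    simp only [ha, pow_zero, one_mul, pow_one]
    linarith
  linarith

theorem lower (P : Matrix V V ℝ) (π : V → ℝ) (hP : IsStochastic P) (hπ : ∀ x, 0 < π x)
    (hrev : IsReversible P π) (B : Finset V) (hB : B.Nonempty) (hlam : topEig P B < 1) :
    ∃ D : Finset V, D ⊆ B ∧ D.Nonempty ∧
      (1 / 100) * (1 - topEig P B)⁻¹ ≤ expExit P (condOn π D) D := by
  by_contra hcon
  push Not at hcon
  have hl : 0 < 1 - topEig P B := by linarith
  obtain ⟨f, hf, hf0, hsupp, hE⟩ := good_test P π hP hπ hrev B hB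
  set c : ℝ := ∑ x, 3 / f x with hc
  have hcn : ∀ x, 0 ≤ 3 / f x := fun x => div_nonneg (by norm_num) (hf0 x)
  have hge : ∀ x, 3 / f x ≤ c := fun x =>
    Finset.single_le_sum (f := fun x => 3 / f x) (fun y _ => hcn y) (Finset.mem_univ x)
  have hfac := faber P π hP hπ hrev B hB hlam ((1 / 100) * (1 - topEig P B)⁻¹) (by positivity)
    (fun D hD hD' => (hcon D hD hD').le) (fun x => c * f x)
    (fun x hx => by rw [hsupp x hx, mul_zero])
    (by
      intro x
      rcases (hf0 x).eq_or_lt with h | h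
      · left; rw [← h, mul_zero]
      · right
        have := (div_le_iff₀ h).1 (hge x)
        linarith)
  obtain ⟨z, hz⟩ := Function.ne_iff.1 hf
  have hz' : 0 < f z := (hf0 z).lt_of_ne' hz
  have hcpos : 0 < c := lt_of_lt_of_le (by positivity) (hge z)
  rw [enw_smul, ipw_smul] at hfac
  have hip := ipw_self_pos π hπ f hf
  have hc2 : 0 < c ^ 2 := by positivity
  have h1 : (1 - topEig P B)⁻¹ * enw P π f f ≤ ipw π f f := by
    rw [inv_mul_le_iff₀ hl]; exact hE
  have h2 := mul_le_mul_of_nonneg_left h1 hc2.le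
  nlinarith [mul_pos hc2 hip]

end Aux

/-- Theorem 2: there is an absolute constant `c₂ > 0` such that for
every irreducible reversible chain and every nonempty `B ⊊ V`,
`c₂/λ(B) ≤ max_{∅ ≠ D ⊆ B} E_{π_D}[T_{Dᶜ}] ≤ 1/λ(B)`. -/
theorem stmt_9 :
    ∃ c₂ : ℝ, 0 < c₂ ∧
      ∀ (V : Type) [Fintype V] [DecidableEq V],
        ∀ (P : Matrix V V ℝ) (π : V → ℝ),
        IsStochastic P → IsIrreducibleMat P → (∀ x, 0 < π x) → (∑ x, π x = 1) →
        IsReversible P π →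
        ∀ B : Finset V, B.Nonempty → B ≠ Finset.univ →
          (∃ D : Finset V, D ⊆ B ∧ D.Nonempty ∧
            c₂ * (1 - topEig P B)⁻¹ ≤ expExit P (condOn π D) D) ∧
          (∀ D : Finset V, D ⊆ B → D.Nonempty →
            expExit P (condOn π D) D ≤ (1 - topEig P B)⁻¹) := by

  refine ⟨1 / 100, by norm_num, ?_⟩
  intro V _ _ P π hP hirr hπ _ hrev B hB hB'
  have hlam := gap_pos P π hP hirr hπ hrev B hB hB'
  exact ⟨lower P π hP hπ hrev B hB hlam, upper P π hP hπ hrev B hB hlam⟩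
end

section
/- Let P be an irreducible reversible transition matrix with respect to a (possibly infinite-mass) measure π on a countable state space V, and let B ⊆ V with 0 < π(B) < ∞. Then the ℓ²(π) operator norm of the restriction P_B equals the supremum of the largest eigenvalues β(D) over all nonempty finite irreducible subsets D ⊆ B: ‖P_B‖ = sup{β(D) : D ⊆ B finite, irreducible, nonempty}. -/
open Finset

section CountableDefs
variable {V : Type*} [Countable V] [DecidableEq V]

/-- Restriction of the kernel `P` to a finite set `D`. -/
def kresF (P : V → V → ℝ) (D : Finset V) : V → V → ℝ :=
  fun x y => if x ∈ D ∧ y ∈ D then P x y else 0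

/-- Powers of the kernel `P` restricted to the finite set `D`. -/
def kpowD (P : V → V → ℝ) (D : Finset V) : ℕ → V → V → ℝ
  | 0 => fun x y => if x = y then 1 else 0
  | n + 1 => fun x y => ∑ z ∈ D, kpowD P D n x z * kresF P D z y

/-- `D` is irreducible for `P`: every state of `D` reaches every other within `D`. -/
def IrreducibleOn (P : V → V → ℝ) (D : Finset V) : Prop :=
  ∀ x ∈ D, ∀ y ∈ D, ∃ n : ℕ, 0 < kpowD P D n x y

/-- The Perron–Frobenius eigenvalue `β(D)` of the restriction of `P` to finite `D`. -/
noncomputable def topEigD (P : V → V → ℝ) (D : Finset V) : ℝ :=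
  sSup {β : ℝ | ∃ f : V → ℝ, f ≠ 0 ∧ (∀ x ∉ D, f x = 0) ∧
    ∀ x, ∑ y ∈ D, kresF P D x y * f y = β * f x}

/-- The operator `P_B` applied to `f` (killed outside `B`). -/
noncomputable def kApply (P : V → V → ℝ) (B : Set V) (f : V → ℝ) : V → ℝ :=
  B.indicator fun x => ∑' y : B, P x y * f y

/-- The `ℓ²(π)` operator norm of `P_B`. -/
noncomputable def opNormSet (P : V → V → ℝ) (π : V → ℝ) (B : Set V) : ℝ :=
  sSup {r : ℝ | ∃ f : V → ℝ, Summable (fun x => π x * f x ^ 2) ∧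
    (∑' x, π x * f x ^ 2) = 1 ∧ r = Real.sqrt (∑' x, π x * kApply P B f x ^ 2)}

/-- Powers of the full kernel `P` on the countable state space. -/
noncomputable def kpow (P : V → V → ℝ) : ℕ → V → V → ℝ
  | 0 => fun x y => if x = y then 1 else 0
  | n + 1 => fun x y => ∑' z, kpow P n x z * P z y

end CountableDefs


section Aux
variable {V : Type*} [Countable V] [DecidableEq V]

lemma aux_kresF_nonneg (P : V → V → ℝ) (hP0 : ∀ x y, 0 ≤ P x y) (D : Finset V) (x y : V) :
    0 ≤ kresF P D x y := by
  unfold kresF; split_ifs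
  · exact hP0 x y
  · exact le_rfl

lemma aux_kpowD_nonneg (P : V → V → ℝ) (hP0 : ∀ x y, 0 ≤ P x y) (D : Finset V) (n : ℕ) :
    ∀ x y, 0 ≤ kpowD P D n x y := by
  induction n with
  | zero => intro x y; unfold kpowD; split_ifs <;> norm_num
  | succ n ih =>
    intro x y
    unfold kpowD
    exact Finset.sum_nonneg fun z _ => mul_nonneg (ih x z) (aux_kresF_nonneg P hP0 D z y)

/-- an eigenvalue of the restriction to finite `D` is at most 1 in absolute value. -/
lemma aux_eig_le_one (P : V → V → ℝ) (hP0 : ∀ x y, 0 ≤ P x y) (hProw : ∀ x, HasSum (P x) 1)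
    (D : Finset V) (β : ℝ) (f : V → ℝ) (hf : f ≠ 0) (hfD : ∀ x ∉ D, f x = 0)
    (he : ∀ x, ∑ y ∈ D, kresF P D x y * f y = β * f x) : β ≤ 1 := by
  obtain ⟨x0, hx0⟩ := Function.ne_iff.mp hf
  have hx0D : x0 ∈ D := by
    by_contra h; exact hx0 (hfD x0 h)
  obtain ⟨x, hxD, hmax⟩ := D.exists_max_image (fun x => |f x|) ⟨x0, hx0D⟩
  have hpos : 0 < |f x| := lt_of_lt_of_le (abs_pos.mpr hx0) (hmax x0 hx0D)
  have h1 : |β| * |f x| ≤ 1 * |f x| := by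
    rw [← abs_mul, ← he x]
    calc |∑ y ∈ D, kresF P D x y * f y| ≤ ∑ y ∈ D, |kresF P D x y * f y| :=
          Finset.abs_sum_le_sum_abs _ _
      _ ≤ ∑ y ∈ D, P x y * |f x| := by
          refine Finset.sum_le_sum fun y hy => ?_
          have : kresF P D x y = P x y := by simp [kresF, hxD, hy]
          rw [this, abs_mul, abs_of_nonneg (hP0 x y)]
          exact mul_le_mul_of_nonneg_left (hmax y hy) (hP0 x y)
      _ = (∑ y ∈ D, P x y) * |f x| := by rw [Finset.sum_mul]
      _ ≤ 1 * |f x| := by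
          gcongr
          exact sum_le_hasSum D (fun y _ => hP0 x y) (hProw x)
  exact (le_abs_self β).trans (le_of_mul_le_mul_right h1 hpos)

lemma aux_bdd (P : V → V → ℝ) (hP0 : ∀ x y, 0 ≤ P x y) (hProw : ∀ x, HasSum (P x) 1)
    (D : Finset V) : BddAbove {β : ℝ | ∃ f : V → ℝ, f ≠ 0 ∧ (∀ x ∉ D, f x = 0) ∧
    ∀ x, ∑ y ∈ D, kresF P D x y * f y = β * f x} :=
  ⟨1, fun β ⟨f, hf, hfD, he⟩ => aux_eig_le_one P hP0 hProw D β f hf hfD he⟩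

lemma aux_topEig_le_one (P : V → V → ℝ) (hP0 : ∀ x y, 0 ≤ P x y) (hProw : ∀ x, HasSum (P x) 1)
    (D : Finset V) : topEigD P D ≤ 1 :=
  Real.sSup_le (fun β ⟨f, hf, hfD, he⟩ => aux_eig_le_one P hP0 hProw D β f hf hfD he) zero_le_one

/-- The target set. -/
def auxSet (P : V → V → ℝ) (B : Set V) : Set ℝ :=
  {β : ℝ | ∃ D : Finset V, ↑D ⊆ B ∧ D.Nonempty ∧ IrreducibleOn P D ∧ β = topEigD P D}

lemma aux_set_bdd (P : V → V → ℝ) (hP0 : ∀ x y, 0 ≤ P x y) (hProw : ∀ x, HasSum (P x) 1)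
    (B : Set V) : BddAbove (auxSet P B) :=
  ⟨1, fun _ ⟨D, _, _, _, h⟩ => h ▸ aux_topEig_le_one P hP0 hProw D⟩

lemma aux_symm {α : Type*} (r : α → α → Prop) (h : ∀ x y, r x y → r y x) {a b : α}
    (hab : Relation.ReflTransGen r a b) : Relation.ReflTransGen r b a := by
  induction hab with
  | refl => exact .refl
  | tail _ hbc ih => exact Relation.ReflTransGen.head (h _ _ hbc) ih

/-- Every eigenvalue of a finite restriction is at most the supremum over irreducible sets. -/
lemma aux_eig_le_sup (P : V → V → ℝ) (π : V → ℝ) (hπpos : ∀ x, 0 < π x)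
    (hP0 : ∀ x y, 0 ≤ P x y) (hProw : ∀ x, HasSum (P x) 1)
    (hrev : ∀ x y, π x * P x y = π y * P y x) (B : Set V)
    (D : Finset V) (hDB : ↑D ⊆ B) (β : ℝ) (f : V → ℝ) (hf : ∃ x ∈ D, f x ≠ 0)
    (he : ∀ x ∈ D, ∑ y ∈ D, P x y * f y = β * f x) : β ≤ sSup (auxSet P B) := by
  classical
  obtain ⟨x0, hx0D, hx0⟩ := hf
  have hPs : ∀ x y, 0 < P x y → 0 < P y x := by
    intro x y h
    have h1 : 0 < π y * P y x := by rw [← hrev]; exact mul_pos (hπpos x) h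
    exact pos_of_mul_pos_right h1 (hπpos y).le
  let r : V → V → Prop := fun x y => x ∈ D ∧ y ∈ D ∧ 0 < P x y
  have hrs : ∀ x y, r x y → r y x := fun x y h => ⟨h.2.1, h.1, hPs _ _ h.2.2⟩
  let C : Finset V := D.filter (fun y => Relation.ReflTransGen r x0 y)
  have hmC : ∀ y, y ∈ C ↔ y ∈ D ∧ Relation.ReflTransGen r x0 y := fun y => Finset.mem_filter
  have hCD : C ⊆ D := Finset.filter_subset _ _
  have hx0C : x0 ∈ C := (hmC _).2 ⟨hx0D, .refl⟩
  have hclosed : ∀ x ∈ C, ∀ y ∈ D, y ∉ C → P x y = 0 := by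
    intro x hx y hy hyC
    by_contra hne
    have : 0 < P x y := lt_of_le_of_ne (hP0 x y) (Ne.symm hne)
    exact hyC ((hmC y).2 ⟨hy, ((hmC x).1 hx).2.tail ⟨hCD hx, hy, this⟩⟩)
  have hreach : ∀ x ∈ C, ∀ y, Relation.ReflTransGen r x y → y ∈ C ∧ ∃ n, 0 < kpowD P C n x y := by
    intro x hx y h
    induction h with
    | refl => exact ⟨hx, 0, by simp [kpowD]⟩
    | @tail b c _ hbc ih =>
      obtain ⟨hb, n, hn⟩ := ih
      have hc : c ∈ C := (hmC c).2 ⟨hbc.2.1, ((hmC b).1 hb).2.tail hbc⟩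
      refine ⟨hc, n + 1, ?_⟩
      have hk : kresF P C b c = P b c := by simp [kresF, hb, hc]
      have h1 : 0 < kpowD P C n x b * kresF P C b c := by
        rw [hk]; exact mul_pos hn hbc.2.2
      refine lt_of_lt_of_le h1 ?_
      change _ ≤ ∑ z ∈ C, kpowD P C n x z * kresF P C z c
      exact Finset.single_le_sum (f := fun z => kpowD P C n x z * kresF P C z c)
        (fun z _ => mul_nonneg (aux_kpowD_nonneg P hP0 C n x z) (aux_kresF_nonneg P hP0 C z c)) hb
  have hirr : IrreducibleOn P C := by
    intro x hx y hy
    refine (hreach x hx y ?_).2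
    have h1 := ((hmC x).1 hx).2
    have h2 := ((hmC y).1 hy).2
    exact (aux_symm r hrs h1).trans h2
  have hmem : topEigD P C ∈ auxSet P B :=
    ⟨C, fun x hx => hDB (hCD hx), ⟨x0, hx0C⟩, hirr, rfl⟩
  refine le_trans ?_ (le_csSup (aux_set_bdd P hP0 hProw B) hmem)
  refine le_csSup (aux_bdd P hP0 hProw C) ⟨fun x => if x ∈ C then f x else 0, ?_, ?_, ?_⟩
  · intro h
    have := congrFun h x0
    simp [hx0C, hx0] at this
  · intro x hx; simp [hx]
  · intro x
    by_cases hx : x ∈ C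
    · simp only [hx, if_true]
      rw [← he x (hCD hx), ← Finset.sum_subset hCD (f := fun y => P x y * f y)]
      · refine Finset.sum_congr rfl fun y hy => ?_
        simp [kresF, hx, hy]
      · intro y hy hyC
        simp [hclosed x hx y hy hyC]
    · simp [kresF, hx]

/-- Rayleigh bound on finite sets. -/
lemma aux_rayleigh (P : V → V → ℝ) (π : V → ℝ) (hπpos : ∀ x, 0 < π x)
    (hP0 : ∀ x y, 0 ≤ P x y) (hProw : ∀ x, HasSum (P x) 1)
    (hrev : ∀ x y, π x * P x y = π y * P y x) (B : Set V)
    (D : Finset V) (hDB : ↑D ⊆ B) (w : V → ℝ) :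
    ∑ x ∈ D, ∑ y ∈ D, π x * P x y * (w x * w y)
      ≤ sSup (auxSet P B) * ∑ x ∈ D, π x * w x ^ 2 := by
  classical
  rcases D.eq_empty_or_nonempty with rfl | hne
  · simp
  have hs : ∀ x, 0 < √(π x) := fun x => Real.sqrt_pos.2 (hπpos x)
  have hss : ∀ x, √(π x) * √(π x) = π x := fun x => Real.mul_self_sqrt (hπpos x).le
  let A : Matrix D D ℝ := Matrix.of fun x y => π x * P x y / (√(π x) * √(π y))
  have hAa : ∀ x y, A x y = π x * P x y / (√(π x) * √(π y)) := fun x y => rfl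
  have hA : A.IsHermitian := by
    ext x y
    rw [Matrix.conjTranspose_apply, star_trivial, hAa, hAa, hrev, mul_comm (√(π y))]
  let T := Matrix.toEuclideanLin A
  have hT : T.IsSymmetric := Matrix.isSymmetric_toEuclideanLin_iff.2 hA
  have hTa : ∀ (v : EuclideanSpace ℝ D) (x : D), T v x = ∑ y : D, A x y * v y := by
    intro v x
    simp [T, Matrix.mulVec, dotProduct]
  have : Nonempty D := hne.to_subtype
  have hev := hT.hasEigenvalue_iSup_of_finiteDimensional
  obtain ⟨lam, hlam⟩ : ∃ lam : ℝ, lam = ⨆ x : { x : EuclideanSpace ℝ D // x ≠ 0 },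
    RCLike.re (inner ℝ (T x) (x : EuclideanSpace ℝ D)) / ‖(x : EuclideanSpace ℝ D)‖ ^ 2 := ⟨_, rfl⟩
  rw [← hlam] at hev
  have hle : lam ≤ sSup (auxSet P B) := by
    obtain ⟨v, hv⟩ := hev.exists_hasEigenvector
    have hv1 : T v = lam • v := hv.apply_eq_smul
    have hv2 : v ≠ 0 := hv.2
    refine aux_eig_le_sup P π hπpos hP0 hProw hrev B D hDB lam
      (fun x => if h : x ∈ D then v ⟨x, h⟩ / √(π x) else 0) ?_ ?_
    · by_contra! hcon
      apply hv2
      ext x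
      have := hcon x x.2
      simpa [(hs x).ne'] using this
    · intro x hx
      have h1 : T v ⟨x, hx⟩ = lam * v ⟨x, hx⟩ := by rw [hv1]; simp
      rw [hTa] at h1
      simp only [hx, dif_pos]
      rw [← mul_div_assoc, ← h1, ← Finset.sum_coe_sort D, Finset.sum_div]
      refine Finset.sum_congr rfl fun y _ => ?_
      simp only [y.2, dif_pos, hAa, Subtype.coe_eta]
      have := (hs x).ne'
      have := (hs y).ne'
      have h5 : √(π x) ^ 2 = π x := by rw [sq, hss]
      field_simp
      rw [h5]
  have hray : ∀ v : EuclideanSpace ℝ D, inner ℝ (T v) v ≤ lam * ‖v‖ ^ 2 := by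
    intro v
    by_cases hv : v = 0
    · simp [hv]
    have hn : 0 < ‖v‖ ^ 2 := by positivity
    rw [← div_le_iff₀ hn, hlam]
    have hb : BddAbove (Set.range fun x : { x : EuclideanSpace ℝ D // x ≠ 0 } =>
        RCLike.re (inner ℝ (T x) (x : EuclideanSpace ℝ D)) / ‖(x : EuclideanSpace ℝ D)‖ ^ 2) := by
      refine ⟨‖LinearMap.toContinuousLinearMap T‖, ?_⟩
      rintro _ ⟨x, rfl⟩
      have hx : 0 < ‖(x : EuclideanSpace ℝ D)‖ := norm_pos_iff.2 x.2
      simp only [RCLike.re_to_real]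
      rw [div_le_iff₀ (by positivity)]
      have h1 := (LinearMap.toContinuousLinearMap T).le_opNorm x
      have h2 := real_inner_le_norm (T x) (x : EuclideanSpace ℝ D)
      have h3 : ‖T x‖ ≤ ‖LinearMap.toContinuousLinearMap T‖ * ‖(x : EuclideanSpace ℝ D)‖ := h1
      nlinarith
    exact le_ciSup hb ⟨v, hv⟩
  let v : EuclideanSpace ℝ D := WithLp.toLp 2 fun x => √(π x) * w x
  have hva : ∀ x : D, v x = √(π x) * w x := fun x => rfl
  have hnorm : ‖v‖ ^ 2 = ∑ x ∈ D, π x * w x ^ 2 := by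
    rw [EuclideanSpace.real_norm_sq_eq, ← Finset.sum_coe_sort D]
    refine Finset.sum_congr rfl fun x _ => ?_
    rw [hva, mul_pow, sq, hss x]
  have hin : inner ℝ (T v) v = ∑ x ∈ D, ∑ y ∈ D, π x * P x y * (w x * w y) := by
    rw [PiLp.inner_apply, ← Finset.sum_coe_sort D]
    refine Finset.sum_congr rfl fun x _ => ?_
    rw [← Finset.sum_coe_sort D, hTa]
    simp only [RCLike.inner_apply, conj_trivial]
    rw [Finset.mul_sum]
    refine Finset.sum_congr rfl fun y _ => ?_
    rw [hAa, hva, hva]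
    have := (hs x).ne'
    have := (hs y).ne'
    field_simp
  rw [← hin, ← hnorm]
  exact (hray v).trans (mul_le_mul_of_nonneg_right hle (by positivity))

lemma aux_sup_nonneg (P : V → V → ℝ) (π : V → ℝ) (hπpos : ∀ x, 0 < π x)
    (hP0 : ∀ x y, 0 ≤ P x y) (hProw : ∀ x, HasSum (P x) 1)
    (hrev : ∀ x y, π x * P x y = π y * P y x) (B : Set V) (hB : B.Nonempty) :
    0 ≤ sSup (auxSet P B) := by
  obtain ⟨x, hx⟩ := hB
  refine (hP0 x x).trans (aux_eig_le_sup P π hπpos hP0 hProw hrev B {x} (by simpa using hx) _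
    (fun _ => 1) ⟨x, by simp, by simp⟩ ?_)
  intro y hy
  obtain rfl := Finset.mem_singleton.1 hy
  simp

/-- Norm bound on finite sets. -/
lemma aux_finite_norm (P : V → V → ℝ) (π : V → ℝ) (hπpos : ∀ x, 0 < π x)
    (hP0 : ∀ x y, 0 ≤ P x y) (hProw : ∀ x, HasSum (P x) 1)
    (hrev : ∀ x y, π x * P x y = π y * P y x) (B : Set V) (hB : B.Nonempty)
    (D : Finset V) (hDB : ↑D ⊆ B) (f : V → ℝ) :
    ∑ x ∈ D, π x * (∑ y ∈ D, P x y * f y) ^ 2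
      ≤ sSup (auxSet P B) ^ 2 * ∑ x ∈ D, π x * f x ^ 2 := by
  have hS0 := aux_sup_nonneg P π hπpos hP0 hProw hrev B hB
  have hR := aux_rayleigh P π hπpos hP0 hProw hrev B D hDB
  set S := sSup (auxSet P B)
  have hR' : ∀ w : V → ℝ, -(∑ x ∈ D, ∑ y ∈ D, π x * P x y * (w x * w y))
      ≤ S * ∑ x ∈ D, π x * w x ^ 2 := by
    intro w
    have h := hR (fun x => |w x|)
    simp only [sq_abs] at h
    refine le_trans ?_ h
    rw [← Finset.sum_neg_distrib]
    refine Finset.sum_le_sum fun x _ => ?_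
    rw [← Finset.sum_neg_distrib]
    refine Finset.sum_le_sum fun y _ => ?_
    rw [← mul_neg, ← abs_mul]
    exact mul_le_mul_of_nonneg_left (neg_le_abs _) (mul_nonneg (hπpos x).le (hP0 x y))
  set u : V → ℝ := fun x => ∑ y ∈ D, P x y * f y with hu
  change ∑ x ∈ D, π x * u x ^ 2 ≤ _
  have hq1 : ∑ x ∈ D, ∑ y ∈ D, π x * P x y * (u x * f y) = ∑ x ∈ D, π x * u x ^ 2 := by
    refine Finset.sum_congr rfl fun x _ => ?_
    rw [sq, hu, ← mul_assoc, Finset.mul_sum]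
    refine Finset.sum_congr rfl fun y _ => ?_
    ring
  have hq2 : ∑ x ∈ D, ∑ y ∈ D, π x * P x y * (f x * u y) = ∑ x ∈ D, π x * u x ^ 2 := by
    rw [Finset.sum_comm, ← hq1]
    refine Finset.sum_congr rfl fun x _ => Finset.sum_congr rfl fun y _ => ?_
    rw [hrev]; ring
  have hU0 : 0 ≤ ∑ x ∈ D, π x * u x ^ 2 :=
    Finset.sum_nonneg fun x _ => mul_nonneg (hπpos x).le (sq_nonneg _)
  have key : ∀ t : ℝ, 4 * t * ∑ x ∈ D, π x * u x ^ 2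
      ≤ 2 * S * (t ^ 2 * ∑ x ∈ D, π x * f x ^ 2 + ∑ x ∈ D, π x * u x ^ 2) := by
    intro t
    have h1 := hR (fun x => t * f x + u x)
    have h2 := hR' (fun x => t * f x - u x)
    have e1 : (∑ x ∈ D, ∑ y ∈ D, π x * P x y * ((t * f x + u x) * (t * f y + u y)))
        - (∑ x ∈ D, ∑ y ∈ D, π x * P x y * ((t * f x - u x) * (t * f y - u y)))
        = 2 * t * (∑ x ∈ D, ∑ y ∈ D, π x * P x y * (u x * f y))
          + 2 * t * (∑ x ∈ D, ∑ y ∈ D, π x * P x y * (f x * u y)) := by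
      simp only [Finset.mul_sum, ← Finset.sum_sub_distrib, ← Finset.sum_add_distrib]
      refine Finset.sum_congr rfl fun x _ => Finset.sum_congr rfl fun y _ => ?_
      ring
    have e2 : (∑ x ∈ D, π x * (t * f x + u x) ^ 2) + (∑ x ∈ D, π x * (t * f x - u x) ^ 2)
        = 2 * (t ^ 2 * ∑ x ∈ D, π x * f x ^ 2 + ∑ x ∈ D, π x * u x ^ 2) := by
      simp only [Finset.mul_sum, ← Finset.sum_add_distrib]
      refine Finset.sum_congr rfl fun x _ => ?_
      ring
    rw [hq1, hq2] at e1
    have e3 := congrArg (fun z => S * z) e2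
    simp only [mul_add (a := S)] at e3
    nlinarith [h1, h2, e1, e3]
  rcases hS0.eq_or_lt with h0 | hpos
  · have := key 1
    rw [← h0] at this ⊢
    linarith
  · have := key S
    have h3 : S * (∑ x ∈ D, π x * u x ^ 2) ≤ S * (S ^ 2 * ∑ x ∈ D, π x * f x ^ 2) := by
      linarith
    exact le_of_mul_le_mul_left h3 hpos

/-- Norm bound on `B`. -/
lemma aux_norm (P : V → V → ℝ) (π : V → ℝ) (hπpos : ∀ x, 0 < π x)
    (hP0 : ∀ x y, 0 ≤ P x y) (hProw : ∀ x, HasSum (P x) 1)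
    (hrev : ∀ x y, π x * P x y = π y * P y x) (B : Set V) (hB : B.Nonempty)
    (f : V → ℝ) (hf : Summable fun x => π x * f x ^ 2) :
    Summable (fun x => π x * kApply P B f x ^ 2) ∧
    ∑' x, π x * kApply P B f x ^ 2 ≤ sSup (auxSet P B) ^ 2 * ∑' x, π x * f x ^ 2 := by
  classical
  have hfin := aux_finite_norm P π hπpos hP0 hProw hrev B hB
  set S := sSup (auxSet P B)
  have hsum : ∀ x, Summable fun y => P x y * f y := by
    intro x
    have hg : Summable fun y => P x y + (π y * f y ^ 2) * (π x)⁻¹ :=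
      (hProw x).summable.add (hf.mul_right _)
    refine Summable.of_norm_bounded hg fun y => ?_
    have hle : P y x ≤ 1 := le_hasSum (hProw y) x fun z _ => hP0 y z
    have h1 : P x y * f y ^ 2 ≤ (π y * f y ^ 2) * (π x)⁻¹ := by
      rw [← div_eq_mul_inv, le_div_iff₀ (hπpos x)]
      have : P x y * f y ^ 2 * π x = (π y * f y ^ 2) * P y x := by
        linear_combination (f y ^ 2) * hrev x y
      rw [this]
      exact mul_le_of_le_one_right (mul_nonneg (hπpos y).le (sq_nonneg _)) hle
    rw [Real.norm_eq_abs, abs_mul, abs_of_nonneg (hP0 x y)]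
    have h2 : |f y| ≤ 1 + f y ^ 2 := by
      rw [← sq_abs]; nlinarith [sq_nonneg (|f y| - 1), abs_nonneg (f y)]
    have h3 := mul_le_mul_of_nonneg_left h2 (hP0 x y)
    linarith
  have hpart : ∀ D : Finset V, ∑ x ∈ D, π x * kApply P B f x ^ 2 ≤ S ^ 2 * ∑' x, π x * f x ^ 2 := by
    intro D
    have hlim : Filter.Tendsto (fun E : Finset V =>
        ∑ x ∈ D, π x * (B.indicator (fun x => ∑ y ∈ E, B.indicator (fun y => P x y * f y) y) x) ^ 2)
        Filter.atTop (nhds (∑ x ∈ D, π x * kApply P B f x ^ 2)) := by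
      refine tendsto_finsetSum _ fun x _ => ?_
      refine (Filter.Tendsto.pow ?_ 2).const_mul _
      by_cases hx : x ∈ B
      · simp only [kApply, Set.indicator_of_mem hx]
        rw [tsum_subtype B (fun y => P x y * f y)]
        exact ((hsum x).indicator B).hasSum
      · simp only [kApply, Set.indicator_of_notMem hx]
        exact tendsto_const_nhds
    refine le_of_tendsto hlim ?_
    filter_upwards [Filter.eventually_ge_atTop D] with E hE
    have hE' : D ⊆ E := hE
    let F := E.filter (· ∈ B)
    have hF := hfin F (by intro x hx; exact (Finset.mem_filter.1 hx).2) f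
    calc _ ≤ ∑ x ∈ E, π x *
          (B.indicator (fun x => ∑ y ∈ E, B.indicator (fun y => P x y * f y) y) x) ^ 2 :=
          Finset.sum_le_sum_of_subset_of_nonneg hE' fun x _ _ =>
            mul_nonneg (hπpos x).le (sq_nonneg _)
      _ = ∑ x ∈ F, π x * (∑ y ∈ F, P x y * f y) ^ 2 := by
          simp only [F]
          rw [Finset.sum_filter]
          refine Finset.sum_congr rfl fun x _ => ?_
          by_cases hx : x ∈ B
          · simp only [Set.indicator_of_mem hx, hx, if_true]
            rw [Finset.sum_filter]
            simp only [Set.indicator_apply]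
          · simp [hx]
      _ ≤ S ^ 2 * ∑ x ∈ F, π x * f x ^ 2 := hF
      _ ≤ _ := by
          refine mul_le_mul_of_nonneg_left ?_ (sq_nonneg _)
          exact hf.sum_le_tsum F fun x _ => mul_nonneg (hπpos x).le (sq_nonneg _)
  have hnn : ∀ x, 0 ≤ π x * kApply P B f x ^ 2 := fun x =>
    mul_nonneg (hπpos x).le (sq_nonneg _)
  have hs : Summable (fun x => π x * kApply P B f x ^ 2) := summable_of_sum_le hnn hpart
  exact ⟨hs, hs.tsum_le_of_sum_le hpart⟩

end Aux

/-- for an irreducible reversible kernel on a countable state space and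
`B ⊆ V` with `0 < π(B) < ∞`, the `ℓ²(π)` operator norm of the restriction `P_B`
equals the supremum of Perron–Frobenius eigenvalues `β(D)` over nonempty finite
irreducible `D ⊆ B`. -/
theorem stmt_19 {V : Type*} [Countable V] [DecidableEq V]
    (P : V → V → ℝ) (π : V → ℝ)
    (hπpos : ∀ x, 0 < π x)
    (hP0 : ∀ x y, 0 ≤ P x y) (hProw : ∀ x, HasSum (P x) 1)
    (hrev : ∀ x y, π x * P x y = π y * P y x)
    (hirr : ∀ x y, ∃ n : ℕ, 0 < kpow P n x y)
    (B : Set V)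
    (hBsum : Summable fun x : B => π x)
    (hBpos : 0 < ∑' x : B, π x) :
    opNormSet P π B
      = sSup {β : ℝ | ∃ D : Finset V, ↑D ⊆ B ∧ D.Nonempty ∧
          IrreducibleOn P D ∧ β = topEigD P D} := by
  classical
  have hB : B.Nonempty := by
    by_contra h
    rw [Set.not_nonempty_iff_eq_empty] at h
    subst h
    simp at hBpos
  have hN := aux_norm P π hπpos hP0 hProw hrev B hB
  have hS0 := aux_sup_nonneg P π hπpos hP0 hProw hrev B hB
  change opNormSet P π B = sSup (auxSet P B)
  have hub : ∀ r ∈ {r : ℝ | ∃ f : V → ℝ, Summable (fun x => π x * f x ^ 2) ∧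
      (∑' x, π x * f x ^ 2) = 1 ∧ r = Real.sqrt (∑' x, π x * kApply P B f x ^ 2)},
      r ≤ sSup (auxSet P B) := by
    rintro r ⟨f, hf, h1, rfl⟩
    have := (hN f hf).2
    rw [h1, mul_one] at this
    exact Real.sqrt_le_iff.2 ⟨hS0, this⟩
  apply le_antisymm
  · exact Real.sSup_le hub hS0
  · have hop0 : 0 ≤ opNormSet P π B := by
      refine Real.sSup_nonneg ?_
      rintro r ⟨f, _, _, rfl⟩
      exact Real.sqrt_nonneg _
    refine Real.sSup_le ?_ hop0
    rintro _ ⟨D, hDB, -, -, rfl⟩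
    refine Real.sSup_le ?_ hop0
    rintro β ⟨f, hf, hfD, he⟩
    obtain ⟨x0, hx0⟩ := Function.ne_iff.mp hf
    have hx0D : x0 ∈ D := by
      by_contra h; exact hx0 (hfD x0 h)
    have hx0' : f x0 ≠ 0 := hx0
    let N : ℝ := ∑ x ∈ D, π x * f x ^ 2
    have hNpos : 0 < N :=
      Finset.sum_pos' (fun x _ => mul_nonneg (hπpos x).le (sq_nonneg _))
        ⟨x0, hx0D, mul_pos (hπpos x0) (by positivity)⟩
    let g : V → ℝ := fun x => |f x| / √N
    have hgD : ∀ x ∉ D, g x = 0 := fun x hx => by simp [g, hfD x hx]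
    have hg0 : ∀ x, 0 ≤ g x := fun x => by positivity
    have hg2 : ∀ x, g x ^ 2 = f x ^ 2 / N := fun x => by
      simp only [g, div_pow, sq_abs, Real.sq_sqrt hNpos.le]
    have hgH : HasSum (fun x => π x * g x ^ 2) (∑ x ∈ D, π x * g x ^ 2) :=
      hasSum_sum_of_ne_finset_zero fun x hx => by simp [hgD x hx]
    have hg1 : ∑ x ∈ D, π x * g x ^ 2 = 1 := by
      simp only [hg2, ← mul_div_assoc]
      rw [← Finset.sum_div]
      exact div_self hNpos.ne'
    have hle : √(∑' x, π x * kApply P B g x ^ 2) ≤ opNormSet P π B :=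
      le_csSup ⟨_, hub⟩ ⟨g, hgH.summable, hgH.tsum_eq.trans hg1, rfl⟩
    refine le_trans (Real.le_sqrt_of_sq_le ?_) hle
    have hpt : ∀ x ∈ D, |β| * g x ≤ kApply P B g x := by
      intro x hx
      have h1 : kApply P B g x = ∑ y ∈ D, P x y * g y := by
        simp only [kApply, Set.indicator_of_mem (hDB hx)]
        rw [tsum_subtype B (fun y => P x y * g y), tsum_eq_sum (s := D)]
        · exact Finset.sum_congr rfl fun y hy => Set.indicator_of_mem (hDB hy) _
        · intro y hy
          simp [Set.indicator_apply, hgD y hy]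
      rw [h1]
      simp only [g, ← mul_div_assoc]
      rw [← Finset.sum_div]
      refine div_le_div_of_nonneg_right ?_ (Real.sqrt_nonneg _)
      rw [← abs_mul, ← he x]
      refine (Finset.abs_sum_le_sum_abs _ _).trans (Finset.sum_le_sum fun y hy => ?_)
      have : kresF P D x y = P x y := by simp [kresF, hx, hy]
      rw [this, abs_mul, abs_of_nonneg (hP0 x y)]
    calc β ^ 2 = β ^ 2 * ∑ x ∈ D, π x * g x ^ 2 := by rw [hg1, mul_one]
      _ = ∑ x ∈ D, π x * (|β| * g x) ^ 2 := by
          rw [Finset.mul_sum]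
          refine Finset.sum_congr rfl fun x _ => ?_
          rw [mul_pow, sq_abs]; ring
      _ ≤ ∑ x ∈ D, π x * kApply P B g x ^ 2 := by
          refine Finset.sum_le_sum fun x hx => ?_
          refine mul_le_mul_of_nonneg_left ?_ (hπpos x).le
          exact pow_le_pow_left₀ (mul_nonneg (abs_nonneg _) (hg0 x)) (hpt x hx) 2
      _ ≤ _ := (hN g hgH.summable).1.sum_le_tsum D fun x _ =>
          mul_nonneg (hπpos x).le (sq_nonneg _)
end
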